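/- arXiv:1205.3007 — 10 statements merged into one kernel-verified Lean document; each statement's English description precedes it below -/
import Mathlib

section
/- Let R be a ring and let M be a nonzero noetherian right R-module. Then M has a monoform submodule. -/
universe u v w

/-- A module `M` over `A` is *monoform* if it is nonzero and for every nonzero submodule `N`
of `M` there is no nonzero submodule of `M` isomorphic to a submodule of `M ⧸ N`.
A right `R`-module is a module over `Rᵐᵒᵖ`. -/
def IsMonoform (A : Type u) [Ring A] (M : Type v) [AddCommGroup M] [Module A M] : Prop :=
  Nontrivial M ∧ ∀ N : Submodule A M, N ≠ ⊥ →
    ¬ ∃ (C : Submodule A M) (f : C →ₗ[A] M ⧸ N), C ≠ ⊥ ∧ Function.Injective f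

/-- If `f : C → Q` is injective, then so is the induced map `C ⧸ K → Q ⧸ f(K)`. -/
theorem Submodule.mapQ_map_injective {A : Type u} [Ring A] {C : Type v} {Q : Type w}
    [AddCommGroup C] [Module A C] [AddCommGroup Q] [Module A Q]
    (f : C →ₗ[A] Q) (hf : Function.Injective f) (K : Submodule A C) :
    Function.Injective (K.mapQ (K.map f) f (Submodule.le_comap_map f K)) := by
  rw [← LinearMap.ker_eq_bot, Submodule.mapQ, Submodule.ker_liftQ, LinearMap.ker_comp,
    Submodule.ker_mkQ, Submodule.comap_map_eq_of_injective hf, Submodule.mkQ_map_self]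

/-- Every nonzero noetherian module has a monoform submodule. -/
theorem IsNoetherian.exists_isMonoform (A : Type u) [Ring A]
    (M : Type v) [AddCommGroup M] [Module A M] [IsNoetherian A M] [Nontrivial M] :
    ∃ N : Submodule A M, IsMonoform A N := by
  let S : Set (Submodule A M) :=
    {N | ∃ (C : Submodule A M) (f : C →ₗ[A] M ⧸ N), C ≠ ⊥ ∧ Function.Injective f}
  have hS : S.Nonempty :=
    ⟨⊥, ⊤, (Submodule.quotEquivOfEqBot ⊥ rfl).symm.toLinearMap ∘ₗ (⊤ : Submodule A M).subtype,
      top_ne_bot, (Submodule.quotEquivOfEqBot (⊥ : Submodule A M) rfl).symm.injective.comp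
        Subtype.val_injective⟩
  obtain ⟨N, ⟨C, f, hC, hf⟩, hmax⟩ := set_has_maximal_iff_noetherian.mpr ‹_› S hS
  refine ⟨C, Submodule.nontrivial_iff_ne_bot.mpr hC, ?_⟩
  rintro K hK ⟨D, g, hD, hg⟩
  have hlt : N < (K.map f).comap N.mkQ := by
    refine lt_of_le_of_ne (Submodule.le_comap_mkQ N _) fun h => hK ?_
    have h_map : K.map f = ⊥ := by
      rw [← Submodule.map_comap_eq_of_surjective N.mkQ_surjective (K.map f), ← h,
        Submodule.mkQ_map_self]
    exact Submodule.map_injective_of_injective hf (h_map.trans (Submodule.map_bot f).symm)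
  let e : ((M ⧸ N) ⧸ K.map f) ≃ₗ[A] M ⧸ (K.map f).comap N.mkQ :=
    (Submodule.quotEquivOfEq _ _
      (Submodule.map_comap_eq_of_surjective N.mkQ_surjective (K.map f)).symm).trans
      (Submodule.quotientQuotientEquivQuotient N _ hlt.le)
  refine hmax _ ⟨D.map C.subtype, e.toLinearMap ∘ₗ
    K.mapQ (K.map f) f (Submodule.le_comap_map f K) ∘ₗ g ∘ₗ
      (Submodule.equivSubtypeMap C D).symm.toLinearMap, ?_, ?_⟩ hlt
  · exact fun h => hD (Submodule.map_injective_of_injective C.injective_subtype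
      (h.trans (Submodule.map_bot _).symm))
  · exact e.injective.comp ((Submodule.mapQ_map_injective f hf K).comp
      (hg.comp (LinearEquiv.injective _)))

/-- Every nonzero noetherian right `R`-module has a monoform submodule. -/
theorem exists_monoform_submodule (R : Type u) [Ring R]
    (M : Type v) [AddCommGroup M] [Module Rᵐᵒᵖ M] [IsNoetherian Rᵐᵒᵖ M]
    (hM : Nontrivial M) :
    ∃ N : Submodule Rᵐᵒᵖ M, IsMonoform Rᵐᵒᵖ N :=
  IsNoetherian.exists_isMonoform Rᵐᵒᵖ M
end

section
/- Let R be a ring and let H₁, H₂, H₃ be monoform right R-modules. If H₁ and H₂ are atom-equivalent and H₂ and H₃ are atom-equivalent, then H₁ and H₃ are atom-equivalent; hence atom equivalence is an equivalence relation on monoform right R-modules. -/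
universe u v w

/-- Two modules are *atom-equivalent* if there is a nonzero module admitting injective
homomorphisms into both of them. -/
def AtomEquivalent (A : Type u) [Ring A] (H : Type v) [AddCommGroup H] [Module A H]
    (H' : Type w) [AddCommGroup H'] [Module A H'] : Prop :=
  ∃ (C : Type (max v w)) (_ : AddCommGroup C) (_ : Module A C), Nontrivial C ∧
    (∃ f : C →ₗ[A] H, Function.Injective f) ∧ (∃ g : C →ₗ[A] H', Function.Injective g)

/-- Monoform modules are uniform: two nonzero submodules meet nontrivially. -/
theorem IsMonoform.inf_ne_bot {A : Type u} [Ring A] {M : Type v} [AddCommGroup M] [Module A M]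
    (hM : IsMonoform A M) {N K : Submodule A M} (hN : N ≠ ⊥) (hK : K ≠ ⊥) : N ⊓ K ≠ ⊥ := by
  intro h
  refine hM.2 K hK ⟨N, K.mkQ ∘ₗ N.subtype, hN, ?_⟩
  rw [← LinearMap.ker_eq_bot, LinearMap.ker_eq_bot']
  rintro ⟨x, hx⟩ hxK
  have hx' : x ∈ N ⊓ K := ⟨hx, by simpa using hxK⟩
  rw [h, Submodule.mem_bot] at hx'
  exact Subtype.ext hx'

/-- A nonzero module embedding into `M` has nonzero range in `M`. -/
theorem LinearMap.range_ne_bot_of_injective {A : Type u} [Ring A] {C : Type w} [AddCommGroup C]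
    [Module A C] [Nontrivial C] {M : Type v} [AddCommGroup M] [Module A M] {f : C →ₗ[A] M}
    (hf : Function.Injective f) : LinearMap.range f ≠ ⊥ := by
  obtain ⟨c, hc⟩ := exists_ne (0 : C)
  intro h
  rw [LinearMap.range_eq_bot] at h
  exact hc (hf (by simp [h]))

/-- Atom equivalence of monoform right `R`-modules is transitive (together with the obvious
reflexivity and symmetry, it is hence an equivalence relation on monoform modules). -/
theorem atomEquivalent_trans (R : Type u) [Ring R]
    (H₁ : Type v) [AddCommGroup H₁] [Module Rᵐᵒᵖ H₁]
    (H₂ : Type v) [AddCommGroup H₂] [Module Rᵐᵒᵖ H₂]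
    (H₃ : Type v) [AddCommGroup H₃] [Module Rᵐᵒᵖ H₃]
    (h₁ : IsMonoform Rᵐᵒᵖ H₁) (h₂ : IsMonoform Rᵐᵒᵖ H₂) (h₃ : IsMonoform Rᵐᵒᵖ H₃)
    (h₁₂ : AtomEquivalent Rᵐᵒᵖ H₁ H₂) (h₂₃ : AtomEquivalent Rᵐᵒᵖ H₂ H₃) :
    AtomEquivalent Rᵐᵒᵖ H₁ H₃ := by
  obtain ⟨C, _, _, _, ⟨f, hf⟩, g, hg⟩ := h₁₂
  obtain ⟨D, _, _, _, ⟨p, hp⟩, q, hq⟩ := h₂₃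
  let eC := (LinearEquiv.ofInjective g hg).symm
  let eD := (LinearEquiv.ofInjective p hp).symm
  refine ⟨↥(LinearMap.range g ⊓ LinearMap.range p), inferInstance, inferInstance,
    Submodule.nontrivial_iff_ne_bot.mpr
      (h₂.inf_ne_bot (LinearMap.range_ne_bot_of_injective hg)
        (LinearMap.range_ne_bot_of_injective hp)),
    ⟨f ∘ₗ eC.toLinearMap ∘ₗ Submodule.inclusion inf_le_left, ?_⟩,
    ⟨q ∘ₗ eD.toLinearMap ∘ₗ Submodule.inclusion inf_le_right, ?_⟩⟩
  · exact hf.comp (eC.injective.comp (Submodule.inclusion_injective _))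
  · exact hq.comp (eD.injective.comp (Submodule.inclusion_injective _))
end

section
/- Let R be a ring, let H and H′ be atom-equivalent monoform right R-modules, let E be an injective hull of H and let E′ be an injective hull of H′. Then E and E′ are isomorphic as right R-modules. -/
universe u v w

/-- A submodule is *essential* if it meets every nonzero submodule nontrivially. -/
def IsEssentialSubmodule {A : Type u} [Ring A] {M : Type v} [AddCommGroup M] [Module A M]
    (N : Submodule A M) : Prop :=
  ∀ L : Submodule A M, L ≠ ⊥ → N ⊓ L ≠ ⊥

section

variable {A : Type u} [Ring A]

/-- A monoform module is uniform: every nonzero submodule is essential. -/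
theorem IsMonoform.isEssentialSubmodule {M : Type v} [AddCommGroup M] [Module A M]
    (hM : IsMonoform A M) {N : Submodule A M} (hN : N ≠ ⊥) : IsEssentialSubmodule N := by
  intro L hL hNL
  refine hM.2 N hN ⟨L, N.mkQ ∘ₗ L.subtype, hL, LinearMap.ker_eq_bot.mp ?_⟩
  rwa [LinearMap.ker_comp, Submodule.ker_mkQ, ← Submodule.disjoint_iff_comap_eq_bot, disjoint_iff,
    inf_comm]

/-- The image of an essential submodule under an embedding with essential range is essential. -/
theorem IsEssentialSubmodule.map {M : Type v} [AddCommGroup M] [Module A M]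
    {P : Type w} [AddCommGroup P] [Module A P] {N : Submodule A M} (hN : IsEssentialSubmodule N)
    {i : M →ₗ[A] P} (hi : Function.Injective i) (hiP : IsEssentialSubmodule (LinearMap.range i)) :
    IsEssentialSubmodule (N.map i) := by
  intro L hL
  have hcomap : L.comap i ≠ ⊥ := by
    intro h
    apply hiP L hL
    rw [← Submodule.map_comap_eq, h, Submodule.map_bot]
  rw [Submodule.map_inf_eq_map_inf_comap, Ne, (Submodule.map_injective_of_injective hi).eq_iff'
    (Submodule.map_bot i)]
  exact hN _ hcomap

/-- A linear map is injective if it is injective on an essential submodule. -/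
theorem IsEssentialSubmodule.injective_of_comp {C : Type*} [AddCommGroup C] [Module A C]
    {M : Type v} [AddCommGroup M] [Module A M] {P : Type w} [AddCommGroup P] [Module A P]
    {a : C →ₗ[A] M} (ha : IsEssentialSubmodule (LinearMap.range a)) {φ : M →ₗ[A] P}
    (hφ : Function.Injective (φ ∘ₗ a)) : Function.Injective φ := by
  rw [← LinearMap.ker_eq_bot]
  by_contra h
  apply ha _ h
  rw [← Submodule.map_comap_eq, ← LinearMap.ker_comp, LinearMap.ker_eq_bot.mpr hφ,
    Submodule.map_bot]

/-- A nonzero map into a monoform module, followed by an embedding with essential range, has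
essential range. -/
theorem IsMonoform.isEssentialSubmodule_range_comp {C : Type*} [AddCommGroup C] [Module A C]
    [Nontrivial C] {M : Type v} [AddCommGroup M] [Module A M] {P : Type w} [AddCommGroup P]
    [Module A P] (hM : IsMonoform A M) {f : C →ₗ[A] M} (hf : Function.Injective f)
    {i : M →ₗ[A] P} (hi : Function.Injective i) (hiP : IsEssentialSubmodule (LinearMap.range i)) :
    IsEssentialSubmodule (LinearMap.range (i ∘ₗ f)) := by
  rw [LinearMap.range_comp]
  refine (hM.isEssentialSubmodule fun h => ?_).map hi hiP
  obtain ⟨c, hc⟩ := exists_ne (0 : C)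
  exact hc (hf (by rw [LinearMap.range_eq_bot.mp h, LinearMap.zero_apply, LinearMap.zero_apply]))

/-- Two injective modules that are essential extensions of the same module are isomorphic. -/
theorem Module.Injective.nonempty_linearEquiv_of_essential {C E E' : Type v}
    [AddCommGroup C] [Module A C] [AddCommGroup E] [Module A E] [Module.Injective A E]
    [AddCommGroup E'] [Module A E'] [Module.Injective A E']
    {a : C →ₗ[A] E} (ha : Function.Injective a) (haE : IsEssentialSubmodule (LinearMap.range a))
    {b : C →ₗ[A] E'} (hb : Function.Injective b) (hbE : IsEssentialSubmodule (LinearMap.range b)) :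
    Nonempty (E ≃ₗ[A] E') := by
  obtain ⟨φ, hφ⟩ := Module.Injective.out a ha b
  have hφa : φ ∘ₗ a = b := LinearMap.ext hφ
  have hφi : Function.Injective φ := haE.injective_of_comp (hφa ▸ hb)
  obtain ⟨ψ, hψ⟩ := Module.Injective.out φ hφi LinearMap.id
  have hψb : ψ ∘ₗ b = a := LinearMap.ext fun c => by simp [← hφ, hψ]
  have hψi : Function.Injective ψ := hbE.injective_of_comp (hψb ▸ ha)
  exact ⟨.ofBijective φ ⟨hφi, fun y => ⟨ψ y, hψi (hψ (ψ y))⟩⟩⟩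

end

/-- Injective hulls of atom-equivalent monoform right `R`-modules are isomorphic. -/
theorem injective_hulls_of_atomEquivalent_isomorphic (R : Type u) [Ring R]
    (H : Type v) [AddCommGroup H] [Module Rᵐᵒᵖ H]
    (H' : Type v) [AddCommGroup H'] [Module Rᵐᵒᵖ H']
    (E : Type v) [AddCommGroup E] [Module Rᵐᵒᵖ E] [Module.Injective Rᵐᵒᵖ E]
    (E' : Type v) [AddCommGroup E'] [Module Rᵐᵒᵖ E'] [Module.Injective Rᵐᵒᵖ E']
    (hH : IsMonoform Rᵐᵒᵖ H) (hH' : IsMonoform Rᵐᵒᵖ H')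
    (hHH' : AtomEquivalent Rᵐᵒᵖ H H')
    (i : H →ₗ[Rᵐᵒᵖ] E) (hi : Function.Injective i)
    (hiE : IsEssentialSubmodule (LinearMap.range i))
    (i' : H' →ₗ[Rᵐᵒᵖ] E') (hi' : Function.Injective i')
    (hiE' : IsEssentialSubmodule (LinearMap.range i')) :
    Nonempty (E ≃ₗ[Rᵐᵒᵖ] E') := by
  obtain ⟨C, _, _, _, ⟨f, hf⟩, ⟨g, hg⟩⟩ := hHH'
  exact Module.Injective.nonempty_linearEquiv_of_essential
    (a := i ∘ₗ f) (hi.comp hf) (hH.isEssentialSubmodule_range_comp hf hi hiE)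
    (b := i' ∘ₗ g) (hi'.comp hg) (hH'.isEssentialSubmodule_range_comp hg hi' hiE')
end

section
/- Let R be a right noetherian ring and let E be a nonzero indecomposable injective right R-module. Let H_E be the intersection of the kernels of all endomorphisms of E that are not automorphisms. Then H_E is a monoform submodule of E and every monoform submodule of E is contained in H_E; in particular, E has a unique maximal monoform submodule, namely H_E. -/
universe u v w

/-- A module is *indecomposable* if it is nonzero and is not the direct sum of two nonzero
submodules. -/
def IsIndecomposableModule (A : Type u) [Ring A] (M : Type v) [AddCommGroup M] [Module A M] :
    Prop :=
  Nontrivial M ∧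
    ¬ ∃ N₁ N₂ : Submodule A M, N₁ ≠ ⊥ ∧ N₂ ≠ ⊥ ∧ N₁ ⊓ N₂ = ⊥ ∧ N₁ ⊔ N₂ = ⊤

section Injective

variable {A : Type u} [Ring A] {E : Type v} [AddCommGroup E] [Module A E]

/-- A submodule disjoint from `K` is contained in a submodule maximal among those disjoint
from `K`. -/
theorem Submodule.exists_le_maximal_disjoint {N K : Submodule A E} (h : Disjoint K N) :
    ∃ L, N ≤ L ∧ Maximal (fun L => Disjoint K L) L := by
  refine zorn_le_nonempty₀ {L | Disjoint K L} (fun c hc hchain y hy => ?_) N h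
  refine ⟨sSup c, ?_, fun z hz => le_sSup hz⟩
  exact (hchain.directedOn.disjoint_sSup_right).2 hc

/-- In an injective module, if `K` is maximal among the submodules disjoint from `N`, and `L ≥ N`
is maximal among the submodules disjoint from `K`, then `L` and `K` span the whole module. -/
theorem Submodule.sup_eq_top_of_maximal_disjoint [Module.Injective A E] {N K L : Submodule A E}
    (hNL : N ≤ L) (hK : Maximal (fun K => Disjoint N K) K)
    (hL : Maximal (fun L => Disjoint K L) L) : L ⊔ K = ⊤ := by
  have hLK : Disjoint L K := hL.prop.symm
  have hinj : Function.Injective (L.subtype.coprod K.subtype) := by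
    rw [← LinearMap.ker_eq_bot, LinearMap.ker_coprod_of_disjoint_range _ _ (by simpa using hLK)]
    simp
  obtain ⟨p, hp⟩ := Module.Injective.out (L.subtype.coprod K.subtype) hinj
    (L.subtype ∘ₗ LinearMap.fst A L K)
  have hpL : ∀ x ∈ L, p x = x := fun x hx => by simpa using hp (⟨x, hx⟩, 0)
  have hpK : ∀ x ∈ K, p x = 0 := fun x hx => by simpa using hp (0, ⟨x, hx⟩)
  have hcomap : K.comap p ≤ K := by
    refine hK.le_of_ge (Submodule.disjoint_def.2 fun x hx hxK => ?_) fun x hx => by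
      simp [hpK x hx]
    rw [Submodule.mem_comap, hpL x (hNL hx)] at hxK
    exact Submodule.disjoint_def.1 hLK x (hNL hx) hxK
  have hrange : LinearMap.range p ≤ L := by
    refine hL.le_of_ge (Submodule.disjoint_def.2 ?_) fun x hx => ⟨x, hpL x hx⟩
    rintro _ hxK ⟨x, rfl⟩
    exact hpK x (hcomap hxK)
  refine eq_top_iff.2 fun x _ => ?_
  have hpx : p x ∈ L := hrange ⟨x, rfl⟩
  rw [← add_sub_cancel (p x) x]
  refine Submodule.add_mem_sup hpx (hcomap ?_)
  simp [hpL _ hpx]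

namespace IsIndecomposableModule

variable [Module.Injective A E]

/-- An indecomposable injective module is uniform. -/
theorem not_disjoint (hE : IsIndecomposableModule A E) {N N' : Submodule A E} (hN : N ≠ ⊥)
    (hN' : N' ≠ ⊥) : ¬ Disjoint N N' := by
  intro h
  obtain ⟨K, hN'K, hK⟩ := Submodule.exists_le_maximal_disjoint h
  obtain ⟨L, hNL, hL⟩ := Submodule.exists_le_maximal_disjoint hK.prop.symm
  exact hE.2 ⟨L, K, ne_bot_of_le_ne_bot hN hNL, ne_bot_of_le_ne_bot hN' hN'K,
    hL.prop.symm.eq_bot, Submodule.sup_eq_top_of_maximal_disjoint hNL hK hL⟩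

/-- An injective endomorphism of an indecomposable injective module is an automorphism. -/
theorem bijective_of_injective (hE : IsIndecomposableModule A E) {f : Module.End A E}
    (hf : Function.Injective f) : Function.Bijective f := by
  have := hE.1
  obtain ⟨g, hg⟩ := Module.Injective.out f hf LinearMap.id
  replace hg : ∀ x, g (f x) = x := hg
  have hker : LinearMap.ker g = ⊥ := by
    by_contra hker
    refine hE.not_disjoint (N := LinearMap.range f) ?_ hker (Submodule.disjoint_def.2 ?_)
    · obtain ⟨x, hx⟩ := exists_ne (0 : E)
      exact (Submodule.ne_bot_iff _).2 ⟨f x, ⟨x, rfl⟩, (map_ne_zero_iff f hf).2 hx⟩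
    · rintro _ ⟨x, rfl⟩ hx
      rw [LinearMap.mem_ker, hg] at hx
      simp [hx]
  exact ⟨hf, fun y => ⟨g y, LinearMap.ker_eq_bot.1 hker (hg _)⟩⟩

theorem not_bijective_iff (hE : IsIndecomposableModule A E) {f : Module.End A E} :
    ¬ Function.Bijective f ↔ LinearMap.ker f ≠ ⊥ := by
  rw [not_iff_not, LinearMap.ker_eq_bot]
  exact ⟨fun h => h.1, hE.bijective_of_injective⟩

theorem exists_ne_zero_forall_mem_ker [IsNoetherianRing A] (hE : IsIndecomposableModule A E) :
    ∃ x : E, x ≠ 0 ∧ ∀ f : Module.End A E, LinearMap.ker f ≠ ⊥ → f x = 0 := by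
  have := hE.1
  obtain ⟨y, hy⟩ := exists_ne (0 : E)
  obtain ⟨_, ⟨x, hx, rfl⟩, hmax⟩ := set_has_maximal_iff_noetherian.2 ‹IsNoetherianRing A›
    {I | ∃ x : E, x ≠ 0 ∧ LinearMap.ker (LinearMap.toSpanSingleton A E x) = I} ⟨_, y, hy, rfl⟩
  refine ⟨x, hx, fun f hf => by_contra fun hfx => ?_⟩
  refine hE.not_disjoint (mt Submodule.span_singleton_eq_bot.1 hx) hf (Submodule.disjoint_def.2 ?_)
  intro z hz hzf
  obtain ⟨a, rfl⟩ := Submodule.mem_span_singleton.1 hz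
  by_contra hax
  refine hmax _ ⟨f x, hfx, rfl⟩ (SetLike.lt_iff_le_and_exists.2 ⟨fun b hb => ?_, a, ?_, ?_⟩)
  · have hb' : b • x = 0 := by simpa using hb
    simp [← map_smul, hb']
  · simpa using hzf
  · simpa using hax

/-- If every endomorphism with nonzero kernel vanishes on a nonzero submodule `H` of an injective
module, then `H` is monoform. -/
theorem _root_.IsMonoform.of_forall_le_ker {H : Submodule A E} (hH : H ≠ ⊥)
    (h : ∀ f : Module.End A E, LinearMap.ker f ≠ ⊥ → H ≤ LinearMap.ker f) : IsMonoform A H := by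
  refine ⟨Submodule.nontrivial_iff_ne_bot.2 hH, ?_⟩
  rintro N hN ⟨C, g, hC, hg⟩
  obtain ⟨k, hk⟩ := Module.Injective.out g hg (H.subtype ∘ₗ C.subtype)
  obtain ⟨f, hf⟩ := Module.Injective.out H.subtype H.injective_subtype (k ∘ₗ N.mkQ)
  have hker : LinearMap.ker f ≠ ⊥ := by
    obtain ⟨n, hn, hn0⟩ := (Submodule.ne_bot_iff _).1 hN
    refine (Submodule.ne_bot_iff _).2 ⟨n, ?_, by simpa using hn0⟩
    have := hf n
    simpa [(Submodule.Quotient.mk_eq_zero N).2 hn] using this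
  obtain ⟨c, hc, hc0⟩ := (Submodule.ne_bot_iff _).1 hC
  obtain ⟨y, hy⟩ := N.mkQ_surjective (g ⟨c, hc⟩)
  refine hc0 (Subtype.ext ?_)
  have h1 : k (g ⟨c, hc⟩) = c := hk ⟨c, hc⟩
  have h2 : f y = k (N.mkQ y) := hf y
  rw [hy, h1] at h2
  exact h2.symm.trans (h f hker y.2)

/-- An endomorphism with nonzero kernel vanishes on every monoform submodule of an indecomposable
injective module. -/
theorem le_ker_of_isMonoform (hE : IsIndecomposableModule A E) {H : Submodule A E}
    (hH : IsMonoform A H) {f : Module.End A E} (hf : LinearMap.ker f ≠ ⊥) :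
    H ≤ LinearMap.ker f := by
  have hH0 : H ≠ ⊥ := Submodule.nontrivial_iff_ne_bot.1 hH.1
  by_contra hHf
  obtain ⟨x, hxH, hx⟩ := SetLike.not_le_iff_exists.1 hHf
  let g : H →ₗ[A] E := f ∘ₗ H.subtype
  refine hH.2 (LinearMap.ker g) ?_ ⟨(LinearMap.range g).comap H.subtype,
    g.quotKerEquivRange.symm.toLinearMap ∘ₗ
      H.subtype.restrict (q := LinearMap.range g) (fun _ hc => hc), ?_, ?_⟩
  · intro hg
    refine hE.not_disjoint hH0 hf (Submodule.disjoint_def.2 fun z hz hzf => ?_)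
    have : (⟨z, hz⟩ : H) ∈ LinearMap.ker g := hzf
    rw [hg] at this
    simpa using this
  · intro hC
    have hg : LinearMap.range g ≠ ⊥ := (Submodule.ne_bot_iff _).2 ⟨f x, ⟨⟨x, hxH⟩, rfl⟩, hx⟩
    refine hE.not_disjoint hH0 hg (Submodule.disjoint_def.2 fun z hz hzg => ?_)
    have : (⟨z, hz⟩ : H) ∈ (LinearMap.range g).comap H.subtype := hzg
    rw [hC] at this
    simpa using this
  · refine g.quotKerEquivRange.symm.injective.comp fun a b hab => ?_
    exact Subtype.ext (Subtype.ext (congrArg (fun z : LinearMap.range g => (z : E)) hab))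

end IsIndecomposableModule

end Injective

/-- Over a right noetherian ring, a nonzero indecomposable injective right module `E` has a
unique maximal monoform submodule, namely the intersection `H_E` of the kernels of all
endomorphisms of `E` that are not automorphisms. -/
theorem unique_maximal_monoform_submodule (R : Type u) [Ring R] [IsNoetherianRing Rᵐᵒᵖ]
    (E : Type v) [AddCommGroup E] [Module Rᵐᵒᵖ E] [Module.Injective Rᵐᵒᵖ E]
    (hE : IsIndecomposableModule Rᵐᵒᵖ E)
    (HE : Submodule Rᵐᵒᵖ E)
    (hHE : HE = ⨅ f ∈ {f : Module.End Rᵐᵒᵖ E | ¬ Function.Bijective f}, LinearMap.ker f) :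
    IsMonoform Rᵐᵒᵖ HE ∧ ∀ H : Submodule Rᵐᵒᵖ E, IsMonoform Rᵐᵒᵖ H → H ≤ HE := by
  have hmem : ∀ x, x ∈ HE ↔ ∀ f : Module.End Rᵐᵒᵖ E, LinearMap.ker f ≠ ⊥ → f x = 0 := by
    simp [hHE, Submodule.mem_iInf, hE.not_bijective_iff]
  refine ⟨IsMonoform.of_forall_le_ker ?_ fun f hf x hx => (hmem x).1 hx f hf,
    fun H hH x hx => (hmem x).2 fun f hf => hE.le_ker_of_isMonoform hH hf hx⟩
  obtain ⟨x, hx0, hx⟩ := hE.exists_ne_zero_forall_mem_ker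
  exact (Submodule.ne_bot_iff _).2 ⟨x, (hmem x).2 hx, hx0⟩
end

section
/- Let R be a right noetherian ring, let E be a nonzero indecomposable injective right R-module, and let H_E be its unique maximal monoform submodule (the intersection of the kernels of all endomorphisms of E that are not automorphisms). Then the endomorphism ring End_R(H_E) is a division ring. -/
universe u v w

namespace Submodule

variable {A : Type*} [Ring A] {M : Type*} [AddCommGroup M] [Module A M]

theorem exists_le_maximal_disjoint_s9 {P Q : Submodule A M} (h : Disjoint P Q) :
    ∃ C, P ≤ C ∧ Maximal (fun C : Submodule A M => Disjoint C Q) C := by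
  refine zorn_le_nonempty₀ {C : Submodule A M | Disjoint C Q} ?_ P h
  intro c hc hchain y hy
  exact ⟨sSup c, hchain.directedOn.disjoint_sSup_left.2 fun b hb => hc hb,
    fun z hz => le_sSup hz⟩

end Submodule

namespace Module.Injective

variable {A : Type u} [Ring A] {E : Type v} [AddCommGroup E] [Module A E] [Module.Injective A E]

theorem exists_isCompl_of_disjoint {P Q : Submodule A E} (h : Disjoint P Q) :
    ∃ C D : Submodule A E, P ≤ C ∧ Q ≤ D ∧ IsCompl C D := by
  obtain ⟨C, hPC, hC⟩ := Submodule.exists_le_maximal_disjoint_s9 h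
  obtain ⟨D, hQD, hD⟩ := Submodule.exists_le_maximal_disjoint_s9 hC.prop.symm
  have hCD : Disjoint C D := hD.prop.symm
  obtain ⟨p, hp⟩ := Module.Injective.out (R := A) (C.subtype.coprod D.subtype)
    (by
      rw [← LinearMap.ker_eq_bot, LinearMap.ker_coprod_of_disjoint_range _ _ (by simpa using hCD)]
      simp)
    (C.subtype ∘ₗ LinearMap.fst A C D)
  have hpC (x : E) (hx : x ∈ C) : p x = x := by simpa using hp (⟨x, hx⟩, 0)
  have hpD (x : E) (hx : x ∈ D) : p x = 0 := by simpa using hp (0, ⟨x, hx⟩)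
  have hcomap : D.comap p ≤ D := by
    refine hD.le_of_ge ?_ fun x hx => by simp [hpD x hx]
    refine Submodule.disjoint_def.2 fun x hx hxC => ?_
    rw [Submodule.mem_comap, hpC x hxC] at hx
    exact Submodule.disjoint_def.1 hCD x hxC hx
  have hrange : LinearMap.range p ≤ C := by
    refine hC.le_of_ge ?_ fun x hx => ⟨x, hpC x hx⟩
    refine Submodule.disjoint_def.2 ?_
    rintro _ ⟨e, rfl⟩ he
    exact hpD e (hcomap (hQD he))
  refine ⟨C, D, hPC, hQD, hCD, codisjoint_iff.2 (Submodule.eq_top_iff'.2 fun e => ?_)⟩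
  have hpe : p e ∈ C := hrange ⟨e, rfl⟩
  refine Submodule.mem_sup.2 ⟨p e, hpe, e - p e, hcomap ?_, by simp⟩
  simp [hpC _ hpe]

end Module.Injective

namespace IsIndecomposableModule

variable {A : Type u} [Ring A] {E : Type v} [AddCommGroup E] [Module A E]

theorem eq_bot_or_eq_bot_of_isCompl (hE : IsIndecomposableModule A E) {P Q : Submodule A E}
    (h : IsCompl P Q) : P = ⊥ ∨ Q = ⊥ := by
  by_contra! hne
  exact hE.2 ⟨P, Q, hne.1, hne.2, h.inf_eq_bot, h.sup_eq_top⟩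

variable [Module.Injective A E]

theorem eq_bot_or_eq_bot_of_disjoint (hE : IsIndecomposableModule A E) {P Q : Submodule A E}
    (h : Disjoint P Q) : P = ⊥ ∨ Q = ⊥ := by
  obtain ⟨C, D, hPC, hQD, hCD⟩ := Module.Injective.exists_isCompl_of_disjoint h
  exact (hE.eq_bot_or_eq_bot_of_isCompl hCD).imp (eq_bot_mono hPC) (eq_bot_mono hQD)

theorem exists_ne_zero_forall_apply_eq_zero [IsNoetherianRing A]
    (hE : IsIndecomposableModule A E) :
    ∃ x : E, x ≠ 0 ∧ ∀ f : Module.End A E, ¬ Function.Bijective f → f x = 0 := by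
  have := hE.1
  obtain ⟨y, hy⟩ := exists_ne (0 : E)
  obtain ⟨I, ⟨x, hx, rfl⟩, hmax⟩ := set_has_maximal_iff_noetherian.2 ‹IsNoetherianRing A›
    {I | ∃ x : E, x ≠ 0 ∧ LinearMap.ker (LinearMap.toSpanSingleton A E x) = I} ⟨_, y, hy, rfl⟩
  refine ⟨x, hx, fun f hf => by_contra fun hfx => hmax _ ⟨f x, hfx, rfl⟩ ?_⟩
  have hker : LinearMap.ker f ≠ ⊥ := fun h =>
    hf (hE.bijective_of_injective (LinearMap.ker_eq_bot.1 h))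
  have hspan : A ∙ x ≠ ⊥ := by simpa using hx
  have hndisj : ¬ Disjoint (LinearMap.ker f) (A ∙ x) := fun h =>
    (hE.eq_bot_or_eq_bot_of_disjoint h).elim hker hspan
  rw [Submodule.disjoint_def] at hndisj
  push Not at hndisj
  obtain ⟨_, hz, hzx, hz0⟩ := hndisj
  obtain ⟨r, rfl⟩ := Submodule.mem_span_singleton.1 hzx
  refine lt_of_le_of_ne (fun s hs => ?_) fun h => hz0 ?_
  · have hs' : s • x = 0 := by simpa using hs
    simp [← map_smul, hs']
  · have hr : r ∈ LinearMap.ker (LinearMap.toSpanSingleton A E (f x)) := by simpa using hz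
    rw [← h] at hr
    simpa using hr

end IsIndecomposableModule

/-- Over a right noetherian ring, the endomorphism ring of the unique maximal monoform
submodule `H_E` of a nonzero indecomposable injective right module `E` is a division ring. -/
theorem end_of_maximal_monoform_is_divisionRing (R : Type u) [Ring R] [IsNoetherianRing Rᵐᵒᵖ]
    (E : Type v) [AddCommGroup E] [Module Rᵐᵒᵖ E] [Module.Injective Rᵐᵒᵖ E]
    (hE : IsIndecomposableModule Rᵐᵒᵖ E)
    (HE : Submodule Rᵐᵒᵖ E)
    (hHE : HE = ⨅ f ∈ {f : Module.End Rᵐᵒᵖ E | ¬ Function.Bijective f}, LinearMap.ker f) :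
    Nontrivial (Module.End Rᵐᵒᵖ HE) ∧
      ∀ φ : Module.End Rᵐᵒᵖ HE, φ ≠ 0 → IsUnit φ := by
  have mem_HE (x : E) : x ∈ HE ↔ ∀ f : Module.End Rᵐᵒᵖ E, ¬ Function.Bijective f → f x = 0 := by
    simp [hHE, Submodule.mem_iInf]
  have map_mem_HE (g : Module.End Rᵐᵒᵖ E) (hg : Function.Bijective g) (x : E) (hx : x ∈ HE) :
      g x ∈ HE := by
    refine (mem_HE _).2 fun f hf => (mem_HE x).1 hx (f * g) fun h => hf ?_
    exact (Function.Bijective.of_comp_iff f hg).1 h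
  obtain ⟨x, hx0, hx⟩ := hE.exists_ne_zero_forall_apply_eq_zero
  have : Nontrivial HE := ⟨⟨⟨x, (mem_HE x).2 hx⟩, 0, fun h => hx0 (congrArg Subtype.val h)⟩⟩
  refine ⟨inferInstance, fun φ hφ => ?_⟩
  obtain ⟨ψ, hψ⟩ := Module.Injective.out (R := Rᵐᵒᵖ) HE.subtype HE.subtype_injective
    (HE.subtype ∘ₗ φ)
  replace hψ (y : HE) : ψ y = φ y := hψ y
  have hbij : Function.Bijective ψ := by
    by_contra h
    refine hφ (LinearMap.ext fun y => Subtype.ext ?_)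
    rw [← hψ]
    exact (mem_HE y).1 y.2 ψ h
  let e := LinearEquiv.ofBijective ψ hbij
  refine (Module.End.isUnit_iff φ).2 ⟨fun y z hyz => ?_, fun y => ?_⟩
  · exact Subtype.ext (hbij.1 (by rw [hψ, hψ, hyz]))
  · refine ⟨⟨e.symm y, map_mem_HE e.symm.toLinearMap e.symm.bijective y y.2⟩, Subtype.ext ?_⟩
    rw [← hψ]
    exact e.apply_symm_apply y
end

section
/- Let R be a right noetherian ring, let E be a nonzero indecomposable injective right R-module, and let H_E be its unique maximal monoform submodule (the intersection of the kernels of all endomorphisms of E that are not automorphisms). Then every endomorphism f of E maps H_E into H_E, the resulting restriction map End_R(E) → End_R(H_E) is a surjective ring homomorphism, and its kernel is exactly the set of endomorphisms of E that are not automorphisms; consequently End_R(E) is a local ring whose residue division ring is isomorphic to End_R(H_E). -/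
universe u v w

section InjectiveModule

variable {A : Type u} [Ring A] {E : Type v} [AddCommGroup E] [Module A E]

/-- Every submodule disjoint from `D` is contained in one that is maximal with this property. -/
theorem Submodule.exists_le_maximal_disjoint_s10 (N D : Submodule A E) (h : Disjoint N D) :
    ∃ C, N ≤ C ∧ Disjoint C D ∧ ∀ C', C ≤ C' → Disjoint C' D → C' = C := by
  obtain ⟨C, hNC, hC⟩ := zorn_le_nonempty₀ {C : Submodule A E | Disjoint C D}
    (fun c hc hchain y hy => by
      refine ⟨sSup c, ?_, fun z hz => le_sSup hz⟩
      rw [Set.mem_ofPred_eq, Submodule.disjoint_def]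
      intro x hx hxD
      obtain ⟨z, hz, hxz⟩ := (Submodule.mem_sSup_of_directed ⟨y, hy⟩ hchain.directedOn).1 hx
      exact Submodule.disjoint_def.1 (hc hz) x hxz hxD) N h
  exact ⟨C, hNC, hC.prop, fun C' h₁ h₂ => le_antisymm (hC.le_of_ge h₂ h₁) h₁⟩

/-- In an injective module, two submodules each of which is maximal among those disjoint from
the other span the whole module. -/
theorem Module.Injective.sup_eq_top_of_maximal_disjoint [Module.Injective A E]
    {C D : Submodule A E} (hCD : Disjoint C D)
    (hC : ∀ C', C ≤ C' → Disjoint C' D → C' = C)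
    (hD : ∀ D', D ≤ D' → Disjoint D' C → D' = D) : C ⊔ D = ⊤ := by
  have hinj : Function.Injective (D.mkQ ∘ₗ C.subtype) := by
    rw [← LinearMap.ker_eq_bot, LinearMap.ker_eq_bot']
    intro x hx
    have hxD : (x : E) ∈ D := by simpa using hx
    exact Subtype.ext (Submodule.disjoint_def.1 hCD x x.2 hxD)
  obtain ⟨g, hg⟩ := Module.Injective.out (D.mkQ ∘ₗ C.subtype) hinj C.subtype
  have hgC : ∀ c ∈ C, g (D.mkQ c) = c := fun c hc => hg ⟨c, hc⟩
  have hker : LinearMap.ker (g ∘ₗ D.mkQ) = D := by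
    refine hD _ (fun d hd => ?_) ?_
    · have : D.mkQ d = 0 := by simpa using hd
      rw [LinearMap.mem_ker, LinearMap.comp_apply, this, map_zero]
    · rw [Submodule.disjoint_def]
      intro x hx hxC
      rw [← hgC x hxC]
      exact hx
  have hcomap : D.comap (g ∘ₗ D.mkQ) = D := by
    refine hD _ (fun d hd => ?_) ?_
    · have : (g ∘ₗ D.mkQ) d = 0 := by rwa [← LinearMap.mem_ker, hker]
      rw [Submodule.mem_comap, this]
      exact zero_mem D
    · rw [Submodule.disjoint_def]
      intro x hx hxC
      have hxD : x ∈ D := by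
        rw [← hgC x hxC]
        exact hx
      exact Submodule.disjoint_def.1 hCD x hxC hxD
  have hrange : LinearMap.range (g ∘ₗ D.mkQ) = C := by
    refine hC _ (fun c hc => ⟨c, hgC c hc⟩) ?_
    rw [Submodule.disjoint_def]
    rintro _ ⟨x, rfl⟩ hx
    have hxD : x ∈ D.comap (g ∘ₗ D.mkQ) := hx
    rwa [hcomap, ← hker] at hxD
  refine eq_top_iff.2 fun e _ => ?_
  set c := (g ∘ₗ D.mkQ) e with hc
  have hcC : c ∈ C := hrange ▸ LinearMap.mem_range_self _ e
  have hsub : e - c ∈ D := by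
    rw [← hker, LinearMap.mem_ker, map_sub, ← hc, sub_eq_zero]
    exact (hgC c hcC).symm
  have := Submodule.add_mem_sup hcC hsub
  rwa [add_sub_cancel] at this

/-- An indecomposable injective module is uniform. -/
theorem IsIndecomposableModule.inf_ne_bot [Module.Injective A E]
    (hE : IsIndecomposableModule A E) {N₁ N₂ : Submodule A E} (h₁ : N₁ ≠ ⊥) (h₂ : N₂ ≠ ⊥) :
    N₁ ⊓ N₂ ≠ ⊥ := by
  intro h
  obtain ⟨C, hNC, hCN, hC⟩ := N₁.exists_le_maximal_disjoint_s10 N₂ (disjoint_iff.2 h)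
  obtain ⟨D, hND, hDC, hD⟩ := N₂.exists_le_maximal_disjoint_s10 C hCN.symm
  exact hE.2 ⟨C, D, ne_bot_of_le_ne_bot h₁ hNC, ne_bot_of_le_ne_bot h₂ hND,
    disjoint_iff.1 hDC.symm, Module.Injective.sup_eq_top_of_maximal_disjoint hDC.symm
      (fun C' h₃ h₄ => hC C' h₃ (h₄.mono_right hND)) hD⟩

/-- An injective endomorphism of an indecomposable injective module is an automorphism. -/
theorem IsIndecomposableModule.bijective_iff_ker_eq_bot [Module.Injective A E]
    (hE : IsIndecomposableModule A E) (f : Module.End A E) :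
    Function.Bijective f ↔ LinearMap.ker f = ⊥ := by
  refine ⟨fun h => LinearMap.ker_eq_bot.2 h.1, fun h => ?_⟩
  have hf := LinearMap.ker_eq_bot.1 h
  obtain ⟨g, hg⟩ := Module.Injective.out f hf LinearMap.id
  have hg' : ∀ x, g (f x) = x := hg
  have := hE.1
  have hrange : LinearMap.range f ≠ ⊥ := by
    obtain ⟨x, hx⟩ := exists_ne (0 : E)
    intro h₀
    have : f x ∈ LinearMap.range f := ⟨x, rfl⟩
    rw [h₀, Submodule.mem_bot] at this
    exact hx (by rw [← hg' x, this, map_zero])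
  have hker : LinearMap.ker g = ⊥ := by
    by_contra hk
    refine hE.inf_ne_bot hrange hk (Submodule.eq_bot_iff _ |>.2 ?_)
    rintro _ ⟨⟨x, rfl⟩, hx⟩
    have hx' : g (f x) = 0 := hx
    rw [hg'] at hx'
    rw [hx', map_zero]
  exact ⟨hf, fun y => ⟨g y, LinearMap.ker_eq_bot.1 hker (hg' (g y))⟩⟩

/-- The endomorphism ring of an indecomposable injective module is local. -/
theorem IsIndecomposableModule.isLocalRing_end [Module.Injective A E]
    (hE : IsIndecomposableModule A E) : IsLocalRing (Module.End A E) := by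
  have := hE.1
  refine { isUnit_or_isUnit_of_add_one := fun {a b} hab => ?_ }
  rw [Module.End.isUnit_iff, Module.End.isUnit_iff, hE.bijective_iff_ker_eq_bot,
    hE.bijective_iff_ker_eq_bot]
  by_contra! h
  refine hE.inf_ne_bot h.1 h.2 (Submodule.eq_bot_iff _ |>.2 ?_)
  rintro x ⟨ha, hb⟩
  have ha' : a x = 0 := ha
  have hb' : b x = 0 := hb
  rw [← Module.End.one_apply (R := A) x, ← hab, LinearMap.add_apply, ha', hb', add_zero]

/-- Over a noetherian ring, the endomorphisms of an indecomposable injective module that are not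
automorphisms have a common nonzero element in their kernels. -/
theorem IsIndecomposableModule.exists_ne_zero_forall_apply_eq_zero_s10 [IsNoetherianRing A]
    [Module.Injective A E] (hE : IsIndecomposableModule A E) :
    ∃ x : E, x ≠ 0 ∧ ∀ f : Module.End A E, ¬ Function.Bijective f → f x = 0 := by
  have := hE.1
  obtain ⟨x₀, hx₀⟩ := exists_ne (0 : E)
  obtain ⟨_, ⟨x, hx, rfl⟩, hmax⟩ := set_has_maximal_iff_noetherian.2 ‹IsNoetherianRing A›
    {I | ∃ x : E, x ≠ 0 ∧ I = LinearMap.ker (LinearMap.toSpanSingleton A E x)} ⟨_, x₀, hx₀, rfl⟩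
  refine ⟨x, hx, fun f hf => ?_⟩
  by_contra hfx
  rw [hE.bijective_iff_ker_eq_bot] at hf
  have hspan : Submodule.span A {x} ≠ ⊥ := by simpa using hx
  refine hE.inf_ne_bot hspan hf (Submodule.eq_bot_iff _ |>.2 ?_)
  rintro y ⟨hy, hfy⟩
  obtain ⟨a, rfl⟩ := Submodule.mem_span_singleton.1 hy
  have hle : LinearMap.ker (LinearMap.toSpanSingleton A E x) ≤
      LinearMap.ker (LinearMap.toSpanSingleton A E (f x)) := by
    intro b hb
    rw [LinearMap.mem_ker, LinearMap.toSpanSingleton_apply] at hb ⊢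
    rw [← map_smul, hb, map_zero]
  have heq := eq_of_le_of_not_lt hle (hmax _ ⟨f x, hfx, rfl⟩)
  have ha : a ∈ LinearMap.ker (LinearMap.toSpanSingleton A E (f x)) := by
    rw [LinearMap.mem_ker, LinearMap.toSpanSingleton_apply, ← map_smul]
    exact hfy
  rwa [← heq, LinearMap.mem_ker, LinearMap.toSpanSingleton_apply] at ha

/-- If `g ∘ f` is an automorphism of an indecomposable injective module, then so is `g`. -/
theorem IsIndecomposableModule.bijective_of_bijective_mul [Module.Injective A E]
    (hE : IsIndecomposableModule A E) {g f : Module.End A E}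
    (h : Function.Bijective (g * f)) : Function.Bijective g := by
  have h' : Function.Bijective (g ∘ f) := h
  have hf : Function.Bijective f :=
    (hE.bijective_iff_ker_eq_bot f).2 (LinearMap.ker_eq_bot.2 h'.1.of_comp)
  exact (Function.Bijective.of_comp_iff _ hf).1 h'

/-- The ring homomorphism restricting endomorphisms to a submodule invariant under all of them. -/
def Submodule.restrictEnd (N : Submodule A E) (h : ∀ f : Module.End A E, ∀ x ∈ N, f x ∈ N) :
    Module.End A E →+* Module.End A N where
  toFun f := f.restrict (h f)
  map_one' := rfl
  map_mul' _ _ := rfl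
  map_zero' := rfl
  map_add' _ _ := rfl

end InjectiveModule

/-- Over a right noetherian ring, every endomorphism of a nonzero indecomposable injective right
module `E` restricts to an endomorphism of the unique maximal monoform submodule `H_E`; the
restriction map `End(E) → End(H_E)` is a surjective ring homomorphism whose kernel consists
exactly of the non-automorphisms, and `End(E)` is a local ring (with residue division ring
`End(H_E)`). -/
theorem end_restriction_surjective_local (R : Type u) [Ring R] [IsNoetherianRing Rᵐᵒᵖ]
    (E : Type v) [AddCommGroup E] [Module Rᵐᵒᵖ E] [Module.Injective Rᵐᵒᵖ E]
    (hE : IsIndecomposableModule Rᵐᵒᵖ E)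
    (HE : Submodule Rᵐᵒᵖ E)
    (hHE : HE = ⨅ f ∈ {f : Module.End Rᵐᵒᵖ E | ¬ Function.Bijective f}, LinearMap.ker f) :
    (∀ f : Module.End Rᵐᵒᵖ E, ∀ x ∈ HE, f x ∈ HE) ∧
    (∃ π : Module.End Rᵐᵒᵖ E →+* Module.End Rᵐᵒᵖ HE,
      (∀ (f : Module.End Rᵐᵒᵖ E) (x : HE), ((π f x : E)) = f (x : E)) ∧
      Function.Surjective π ∧
      (∀ f : Module.End Rᵐᵒᵖ E, π f = 0 ↔ ¬ Function.Bijective f)) ∧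
    IsLocalRing (Module.End Rᵐᵒᵖ E) := by
  have hmem : ∀ x, x ∈ HE ↔ ∀ f : Module.End Rᵐᵒᵖ E, ¬ Function.Bijective f → f x = 0 := by
    intro x
    simp [hHE, Submodule.mem_iInf]
  have hinv : ∀ f : Module.End Rᵐᵒᵖ E, ∀ x ∈ HE, f x ∈ HE := fun f x hx =>
    (hmem _).2 fun g hg => (hmem x).1 hx (g * f) fun h => hg (hE.bijective_of_bijective_mul h)
  refine ⟨hinv, ⟨HE.restrictEnd hinv, fun _ _ => rfl, fun h => ?_, fun f => ⟨fun h hf => ?_,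
    fun hf => ?_⟩⟩, hE.isLocalRing_end⟩
  · obtain ⟨f, hf⟩ := Module.Injective.out HE.subtype HE.injective_subtype (HE.subtype ∘ₗ h)
    exact ⟨f, LinearMap.ext fun x => Subtype.ext (hf x)⟩
  · obtain ⟨x, hx, hx'⟩ := hE.exists_ne_zero_forall_apply_eq_zero_s10
    have hfx : f x = 0 := congrArg Subtype.val (LinearMap.congr_fun h ⟨x, (hmem x).2 hx'⟩)
    exact hx (hf.1 (hfx.trans (map_zero f).symm))
  · exact LinearMap.ext fun x => Subtype.ext ((hmem x).1 x.2 f hf)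
end

section
/- Let R be a right noetherian ring and let E be a nonzero indecomposable injective right R-module. Consider the functor F from right R-modules to abelian groups sending M to the filtered colimit, over the directed set of nonzero submodules U of E ordered by reverse inclusion with restriction maps as transition maps, of Hom_R(U, M). Then F is representable, i.e. naturally isomorphic to Hom_R(V, −) for some right R-module V, if and only if E contains a simple submodule. -/
universe u v w

/-- The filtered colimit `colim Hom_R(U, M)`, taken over the directed set of nonzero submodules
`U` of `E` ordered by reverse inclusion with the restriction maps as transition maps, realized
as a quotient of the disjoint union of the `Hom_R(U, M)`: two homomorphisms are identified when
they agree on a common nonzero submodule. -/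
def HomGerm (R : Type u) [Ring R] (E : Type v) [AddCommGroup E] [Module Rᵐᵒᵖ E]
    (M : Type v) [AddCommGroup M] [Module Rᵐᵒᵖ M] : Type v :=
  Quot (fun (p q : Σ U : {U : Submodule Rᵐᵒᵖ E // U ≠ ⊥}, (↥U.1 →ₗ[Rᵐᵒᵖ] M)) =>
    ∃ (W : Submodule Rᵐᵒᵖ E) (_ : W ≠ ⊥) (hWp : W ≤ p.1.1) (hWq : W ≤ q.1.1),
      ∀ (x : E) (hx : x ∈ W), p.2 ⟨x, hWp hx⟩ = q.2 ⟨x, hWq hx⟩)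

/-- The action of the functor `M ↦ colim_U Hom_R(U, M)` on a homomorphism `g : M → N`,
given by postcomposition with `g`. -/
def HomGerm.map (R : Type u) [Ring R] (E : Type v) [AddCommGroup E] [Module Rᵐᵒᵖ E]
    {M : Type v} [AddCommGroup M] [Module Rᵐᵒᵖ M]
    {N : Type v} [AddCommGroup N] [Module Rᵐᵒᵖ N]
    (g : M →ₗ[Rᵐᵒᵖ] N) : HomGerm R E M → HomGerm R E N :=
  Quot.map (fun p => ⟨p.1, g.comp p.2⟩) (by
    rintro p q ⟨W, hW, hWp, hWq, h⟩
    exact ⟨W, hW, hWp, hWq, fun x hx => by simp [LinearMap.comp_apply, h x hx]⟩)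

/-- Among the submodules containing `W` and disjoint from `U` there is a maximal one. -/
theorem exists_le_maximal_disjoint_submodule {A : Type u} [Ring A] {M : Type v} [AddCommGroup M]
    [Module A M] {U W : Submodule A M} (h : Disjoint W U) :
    ∃ W', W ≤ W' ∧ Maximal (fun X : Submodule A M => Disjoint X U) W' := by
  refine zorn_le_nonempty₀ {X : Submodule A M | Disjoint X U} (fun c hc hchain y hy => ?_) W h
  refine ⟨sSup c, ?_, fun z hz => le_sSup hz⟩
  have hdir : DirectedOn (· ≤ ·) c := hchain.directedOn
  exact (hdir.disjoint_sSup_left).2 fun X hX => hc hX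

/-- An indecomposable injective module is uniform: any two nonzero submodules intersect
nontrivially. -/
theorem IsIndecomposableModule.inf_ne_bot_of_injective {A : Type u} [Ring A] {E : Type v}
    [AddCommGroup E] [Module A E] [Module.Injective A E] (hE : IsIndecomposableModule A E)
    {U W : Submodule A E} (hU : U ≠ ⊥) (hW : W ≠ ⊥) : U ⊓ W ≠ ⊥ := by
  intro hUW
  obtain ⟨W', hWW', hW'⟩ := exists_le_maximal_disjoint_submodule (disjoint_iff.2 hUW).symm
  obtain ⟨U', hUU', hU'⟩ := exists_le_maximal_disjoint_submodule hW'.prop.symm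
  have hdisj : ∀ x ∈ U', x ∈ W' → x = 0 := fun x hx hx' =>
    Submodule.disjoint_def.1 hU'.prop x hx hx'
  let i : U' × W' →ₗ[A] E := U'.subtype.coprod W'.subtype
  have hi : Function.Injective i := by
    rw [injective_iff_map_eq_zero]
    rintro ⟨a, b⟩ hab
    have hab' : (a : E) + b = 0 := by simpa [i] using hab
    have ha : (a : E) = 0 := hdisj a a.2 (by
      rw [eq_neg_of_add_eq_zero_left hab']
      exact W'.neg_mem b.2)
    have hb : (b : E) = 0 := by simpa [ha] using hab'
    exact Prod.ext (Subtype.ext ha) (Subtype.ext hb)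
  obtain ⟨f, hf⟩ := Module.Injective.out i hi (U'.subtype.comp (LinearMap.fst A U' W'))
  have hfU : ∀ x ∈ U', f x = x := fun x hx => by
    simpa [i] using hf (⟨x, hx⟩, 0)
  have hfW : ∀ x ∈ W', f x = 0 := fun x hx => by
    simpa [i] using hf (0, ⟨x, hx⟩)
  have hker : LinearMap.ker f ≤ W' := by
    refine hW'.le_of_ge (Submodule.disjoint_def.2 fun x hx hxU => ?_) fun x hx => hfW x hx
    rw [← hfU x (hUU' hxU)]
    exact hx
  have hrange : Disjoint (LinearMap.range f) W' := by
    have hcomap : W'.comap f ≤ W' := by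
      refine hW'.le_of_ge (Submodule.disjoint_def.2 fun x hx hxU => ?_) fun x hx => ?_
      · have hx' : f x ∈ W' := hx
        rw [hfU x (hUU' hxU)] at hx'
        exact hdisj x (hUU' hxU) hx'
      · change f x ∈ W'
        rw [hfW x hx]
        exact W'.zero_mem
    rw [Submodule.disjoint_def]
    rintro _ ⟨y, rfl⟩ hy
    exact hfW y (hcomap hy)
  have hrangeU : LinearMap.range f ≤ U' :=
    hU'.le_of_ge hrange fun x hx => ⟨x, hfU x hx⟩
  refine hE.2 ⟨U', W', ne_bot_of_le_ne_bot hU hUU', ne_bot_of_le_ne_bot hW hWW',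
    disjoint_iff.1 hU'.prop, eq_top_iff.2 fun x _ => ?_⟩
  have hfx : f x ∈ U' := hrangeU ⟨x, rfl⟩
  refine Submodule.mem_sup.2 ⟨f x, hfx, x - f x, hker ?_, add_sub_cancel _ _⟩
  rw [LinearMap.mem_ker, map_sub, hfU _ hfx, sub_self]

/-- Over a uniform module, a germ of homomorphisms represented by the zero map is not represented
by an injective map. -/
theorem HomGerm.mk_zero_ne_mk_of_injective {R : Type u} [Ring R] {E : Type v} [AddCommGroup E]
    [Module Rᵐᵒᵖ E] (hE : ∀ U W : Submodule Rᵐᵒᵖ E, U ≠ ⊥ → W ≠ ⊥ → U ⊓ W ≠ ⊥)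
    {M : Type v} [AddCommGroup M] [Module Rᵐᵒᵖ M]
    {U W : {U : Submodule Rᵐᵒᵖ E // U ≠ ⊥}} (f : W.1 →ₗ[Rᵐᵒᵖ] M) (hf : Function.Injective f) :
    (Quot.mk _ ⟨U, 0⟩ : HomGerm R E M) ≠ Quot.mk _ ⟨W, f⟩ := by
  intro h
  let Vanishes (p : Σ U : {U : Submodule Rᵐᵒᵖ E // U ≠ ⊥}, (U.1 →ₗ[Rᵐᵒᵖ] M)) : Prop :=
    ∃ (X : Submodule Rᵐᵒᵖ E) (_ : X ≠ ⊥) (hX : X ≤ p.1.1), ∀ x (hx : x ∈ X), p.2 ⟨x, hX hx⟩ = 0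
  let vanishes : HomGerm R E M → Prop := Quot.lift Vanishes (by
    rintro p q ⟨Y, hY, hYp, hYq, hpq⟩
    refine propext ⟨?_, ?_⟩
    · rintro ⟨X, hX, hXp, h0⟩
      refine ⟨X ⊓ Y, hE X Y hX hY, inf_le_right.trans hYq, fun x hx => ?_⟩
      rw [← hpq x hx.2]
      exact h0 x hx.1
    · rintro ⟨X, hX, hXq, h0⟩
      refine ⟨X ⊓ Y, hE X Y hX hY, inf_le_right.trans hYp, fun x hx => ?_⟩
      rw [hpq x hx.2]
      exact h0 x hx.1)
  have hzero : vanishes (Quot.mk _ ⟨U, 0⟩) := ⟨U.1, U.2, le_rfl, fun _ _ => rfl⟩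
  rw [h] at hzero
  obtain ⟨X, hX, hXW, h0⟩ := hzero
  refine hX ((Submodule.eq_bot_iff X).2 fun x hx => ?_)
  exact congrArg Subtype.val (hf ((h0 x hx).trans (map_zero f).symm))

/-- If a simple submodule `S` of `E` is contained in every nonzero submodule, then germs of
homomorphisms are the same as homomorphisms defined on `S`. -/
def HomGerm.equivOfLeast (R : Type u) [Ring R] {E : Type v} [AddCommGroup E] [Module Rᵐᵒᵖ E]
    {S : Submodule Rᵐᵒᵖ E} (hS : S ≠ ⊥) (hle : ∀ U : Submodule Rᵐᵒᵖ E, U ≠ ⊥ → S ≤ U)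
    (M : Type v) [AddCommGroup M] [Module Rᵐᵒᵖ M] :
    (S →ₗ[Rᵐᵒᵖ] M) ≃ HomGerm R E M where
  toFun f := Quot.mk _ ⟨⟨S, hS⟩, f⟩
  invFun := Quot.lift (fun p => p.2.comp (Submodule.inclusion (hle p.1.1 p.1.2))) (by
    rintro p q ⟨W, hW, hWp, hWq, h⟩
    ext x
    exact h x (hle W hW x.2))
  left_inv f := rfl
  right_inv := by
    rintro ⟨p⟩
    exact Quot.sound ⟨S, hS, le_rfl, hle p.1.1 p.1.2, fun x hx => rfl⟩

/-- Over a right noetherian ring `R`, for a nonzero indecomposable injective right `R`-module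
`E`, the functor `M ↦ colim_{0 ≠ U ≤ E} Hom_R(U, M)` is representable, i.e. naturally
isomorphic to `Hom_R(V, −)` for some right `R`-module `V`, if and only if `E` contains a
simple submodule. -/
theorem homGerm_representable_iff_exists_simple_submodule
    (R : Type u) [Ring R] [IsNoetherianRing Rᵐᵒᵖ]
    (E : Type v) [AddCommGroup E] [Module Rᵐᵒᵖ E] [Module.Injective Rᵐᵒᵖ E]
    (hE : IsIndecomposableModule Rᵐᵒᵖ E) :
    (∃ (V : Type v) (_ : AddCommGroup V) (_ : Module Rᵐᵒᵖ V)
        (e : ∀ (M : Type v) (iM : AddCommGroup M) (jM : Module Rᵐᵒᵖ M),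
          (V →ₗ[Rᵐᵒᵖ] M) ≃ HomGerm R E M),
      ∀ (M : Type v) (iM : AddCommGroup M) (jM : Module Rᵐᵒᵖ M)
        (N : Type v) (iN : AddCommGroup N) (jN : Module Rᵐᵒᵖ N)
        (g : M →ₗ[Rᵐᵒᵖ] N) (h : V →ₗ[Rᵐᵒᵖ] M),
        e N iN jN (g.comp h) = HomGerm.map R E g (e M iM jM h)) ↔
    ∃ S : Submodule Rᵐᵒᵖ E, S ≠ ⊥ ∧ IsSimpleModule Rᵐᵒᵖ S := by
  have hunif : ∀ U W : Submodule Rᵐᵒᵖ E, U ≠ ⊥ → W ≠ ⊥ → U ⊓ W ≠ ⊥ := fun U W hU hW =>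
    hE.inf_ne_bot_of_injective hU hW
  constructor
  · rintro ⟨V, iV, jV, e, he⟩
    obtain ⟨⟨⟨U, hU⟩, f⟩, huniv⟩ := Quot.exists_rep (e V iV jV LinearMap.id)
    -- every nonzero submodule of `U` is mapped onto `V` by the universal germ
    have hmap : ∀ (W : Submodule Rᵐᵒᵖ E), W ≠ ⊥ → ∀ hWU : W ≤ U,
        LinearMap.range (f.comp (Submodule.inclusion hWU)) = ⊤ := by
      intro W hW hWU
      set K := LinearMap.range (f.comp (Submodule.inclusion hWU)) with hK
      have hq : K.mkQ = 0 := by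
        apply (e (V ⧸ K) _ _).injective
        have h1 := he V iV jV (V ⧸ K) _ _ K.mkQ LinearMap.id
        have h2 := he V iV jV (V ⧸ K) _ _ 0 LinearMap.id
        rw [LinearMap.comp_id, ← huniv] at h1 h2
        rw [h1, h2]
        refine Quot.sound ⟨W, hW, hWU, hWU, fun x hx => ?_⟩
        exact (Submodule.Quotient.mk_eq_zero K).2 ⟨⟨x, hx⟩, rfl⟩
      rw [← K.ker_mkQ, hq, LinearMap.ker_zero]
    have hinj : ∀ x (hx : x ∈ U), f ⟨x, hx⟩ = 0 → x = 0 := by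
      by_contra! hcon
      obtain ⟨x, hx, hfx, hx0⟩ := hcon
      have hne : (LinearMap.ker f).map U.subtype ≠ ⊥ := fun hbot =>
        hx0 ((Submodule.eq_bot_iff _).1 hbot x ⟨⟨x, hx⟩, hfx, rfl⟩)
      have htop := hmap _ hne (Submodule.map_subtype_le U _)
      have hV : ∀ v : V, v = 0 := by
        intro v
        have hv : v ∈ (⊤ : Submodule Rᵐᵒᵖ V) := trivial
        rw [← htop] at hv
        obtain ⟨⟨_, y, hy, rfl⟩, rfl⟩ := hv
        exact hy
      have hsub : ∀ g h : V →ₗ[Rᵐᵒᵖ] E, g = h := fun g h =>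
        LinearMap.ext fun v => by rw [hV v, map_zero, map_zero]
      refine HomGerm.mk_zero_ne_mk_of_injective (U := ⟨U, hU⟩) (W := ⟨U, hU⟩) hunif U.subtype
        Subtype.val_injective ?_
      exact (e E _ _).symm.injective (hsub _ _)
    refine ⟨U, hU, isSimpleModule_iff_isAtom.2 ⟨hU, fun W hWU => ?_⟩⟩
    by_contra hW
    refine hWU.not_ge fun x hx => ?_
    have hfx : f ⟨x, hx⟩ ∈ LinearMap.range (f.comp (Submodule.inclusion hWU.le)) := by
      rw [hmap W hW hWU.le]
      trivial
    obtain ⟨w, hw⟩ := hfx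
    have hxw : x - w = 0 := by
      refine hinj (x - w) (U.sub_mem hx (hWU.le w.2)) ?_
      have hsub := map_sub f ⟨x, hx⟩ (Submodule.inclusion hWU.le w)
      rw [← hw, LinearMap.comp_apply, sub_self] at hsub
      exact hsub
    rw [sub_eq_zero.1 hxw]
    exact w.2
  · rintro ⟨S, hS, hsimple⟩
    have hle : ∀ U : Submodule Rᵐᵒᵖ E, U ≠ ⊥ → S ≤ U := fun U hU =>
      ((isSimpleModule_iff_isAtom.1 hsimple).not_disjoint_iff_le).1 fun hd =>
        hunif S U hS hU hd.eq_bot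
    exact ⟨S, inferInstance, inferInstance,
      fun M _ _ => HomGerm.equivOfLeast R hS hle M, fun _ _ _ _ _ _ _ _ => rfl⟩
end

section
/- Let R be a ring, let M be a right R-module and let N be a submodule of M. Then every monoform submodule H of M is atom-equivalent either to a monoform submodule of N or to a monoform submodule of M/N. -/
universe u v w

/-- A nonzero module that embeds into a monoform module is monoform. -/
theorem IsMonoform.of_injective {A : Type u} [Ring A] {H : Type v} [AddCommGroup H] [Module A H]
    {L : Type w} [AddCommGroup L] [Module A L] [Nontrivial L] (hH : IsMonoform A H)
    (g : L →ₗ[A] H) (hg : Function.Injective g) : IsMonoform A L := by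
  refine ⟨inferInstance, ?_⟩
  rintro K hK ⟨C, f, hC, hf⟩
  let q : (L ⧸ K) →ₗ[A] H ⧸ K.map g := K.mapQ (K.map g) g (Submodule.le_comap_map g K)
  have hq : Function.Injective q := by
    rw [← LinearMap.ker_eq_bot, Submodule.ker_mapQ, Submodule.comap_map_eq_of_injective hg,
      Submodule.mkQ_map_self]
  let e : C ≃ₗ[A] C.map g := Submodule.equivMapOfInjective g hg C
  refine hH.2 (K.map g) ?_ ⟨C.map g, q ∘ₗ f ∘ₗ e.symm.toLinearMap, ?_, ?_⟩
  · exact fun h => hK ((Submodule.map_injective_of_injective hg) (h.trans (Submodule.map_bot g).symm))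
  · exact fun h => hC ((Submodule.map_injective_of_injective hg) (h.trans (Submodule.map_bot g).symm))
  · exact hq.comp (hf.comp e.symm.injective)

/-- A nonzero module that embeds into another module is atom-equivalent to it. -/
theorem AtomEquivalent.of_injective {A : Type u} [Ring A] {H L : Type v} [AddCommGroup H]
    [Module A H] [AddCommGroup L] [Module A L] [Nontrivial L]
    (g : L →ₗ[A] H) (hg : Function.Injective g) : AtomEquivalent A H L :=
  ⟨L, inferInstance, inferInstance, inferInstance, ⟨g, hg⟩, LinearMap.id, Function.injective_id⟩

/-- For a submodule `N` of a right `R`-module `M`, every monoform submodule `H` of `M` is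
atom-equivalent to a monoform submodule of `N` or to a monoform submodule of `M ⧸ N`. -/
theorem monoform_submodule_atomEquivalent_sub_or_quotient (R : Type u) [Ring R]
    (M : Type v) [AddCommGroup M] [Module Rᵐᵒᵖ M]
    (N : Submodule Rᵐᵒᵖ M) (H : Submodule Rᵐᵒᵖ M) (hH : IsMonoform Rᵐᵒᵖ H) :
    (∃ H' : Submodule Rᵐᵒᵖ N, IsMonoform Rᵐᵒᵖ H' ∧ AtomEquivalent Rᵐᵒᵖ H H') ∨
    (∃ H'' : Submodule Rᵐᵒᵖ (M ⧸ N), IsMonoform Rᵐᵒᵖ H'' ∧ AtomEquivalent Rᵐᵒᵖ H H'') := by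
  by_cases h : Disjoint H N
  · right
    have hinj : Function.Injective (N.mkQ ∘ₗ H.subtype) := by
      rw [← LinearMap.ker_eq_bot, LinearMap.ker_comp, Submodule.ker_mkQ,
        ← Submodule.disjoint_iff_comap_eq_bot]
      exact h
    let e := LinearEquiv.ofInjective _ hinj
    have := hH.1
    have := e.symm.toEquiv.nontrivial
    exact ⟨_, hH.of_injective e.symm.toLinearMap e.symm.injective,
      .of_injective e.symm.toLinearMap e.symm.injective⟩
  · left
    let g : H.comap N.subtype →ₗ[Rᵐᵒᵖ] H := N.subtype.restrict fun _ hx => hx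
    have hg : Function.Injective g := fun x y hxy =>
      Subtype.ext (Subtype.ext (congrArg (fun z : H => (z : M)) hxy))
    have : Nontrivial (H.comap N.subtype) := by
      rw [Submodule.nontrivial_iff_ne_bot]
      exact fun hb => h (Submodule.disjoint_iff_comap_eq_bot.mpr hb).symm
    exact ⟨_, hH.of_injective g hg, .of_injective g hg⟩
end

section
/- Let R be a commutative noetherian ring, let Λ be a ring containing R as a subring of its center such that Λ is finitely generated as an R-module, let p be a prime ideal of R, let Λ_p = Λ ⊗_R R_p, and let φ : Λ → Λ_p be the canonical ring homomorphism. Then the map sending a prime two-sided ideal Q of Λ with Q ∩ R ⊆ p to the two-sided ideal QΛ_p of Λ_p generated by φ(Q) is a bijection from {prime two-sided ideals Q of Λ with Q ∩ R ⊆ p} onto the set of prime two-sided ideals of Λ_p, with inverse given by Q′ ↦ φ⁻¹(Q′). -/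
universe u v

open scoped TensorProduct

/-- The annihilator of a right `Λ`-module (i.e. a `Λᵐᵒᵖ`-module) `S`, as a two-sided ideal of
`Λ`: it consists of all `a : Λ` with `S • a = 0`. -/
def rightAnnihilator (Λ : Type u) [Ring Λ] (S : Type v) [AddCommGroup S]
    [Module Λᵐᵒᵖ S] : TwoSidedIdeal Λ :=
  TwoSidedIdeal.mk' {a : Λ | ∀ x : S, MulOpposite.op a • x = 0}
    (fun x => by simp)
    (fun {a b} ha hb x => by
      rw [Set.mem_setOf_eq] at ha hb
      rw [MulOpposite.op_add, add_smul, ha x, hb x, add_zero])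
    (fun {a} ha x => by
      rw [Set.mem_setOf_eq] at ha
      rw [MulOpposite.op_neg, neg_smul, ha x, neg_zero])
    (fun {a b} hb x => by
      rw [Set.mem_setOf_eq] at hb
      rw [MulOpposite.op_mul, mul_smul]; exact hb _)
    (fun {a b} ha x => by
      rw [Set.mem_setOf_eq] at ha
      rw [MulOpposite.op_mul, mul_smul, ha x, smul_zero])

/-- A two-sided ideal `P` of `Λ` is *prime* if it is proper and `a Λ b ⊆ P` implies `a ∈ P` or
`b ∈ P`. -/
def IsPrimeTwoSided {Λ : Type u} [Ring Λ] (P : TwoSidedIdeal Λ) : Prop :=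
  P ≠ ⊤ ∧ ∀ a b : Λ, (∀ x : Λ, a * x * b ∈ P) → a ∈ P ∨ b ∈ P

/-- A two-sided ideal of `Λ` is *maximal* if it is a maximal element of the set of proper
two-sided ideals of `Λ`. -/
def IsMaximalTwoSided {Λ : Type u} [Ring Λ] (P : TwoSidedIdeal Λ) : Prop :=
  P ≠ ⊤ ∧ ∀ Q : TwoSidedIdeal Λ, P < Q → Q = ⊤

/-- A two-sided ideal of `Λ`, viewed as a submodule of `Λ` as a right module over itself. -/
def TwoSidedIdeal.toRightSubmodule {Λ : Type u} [Ring Λ] (P : TwoSidedIdeal Λ) :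
    Submodule Λᵐᵒᵖ Λ where
  carrier := P
  zero_mem' := P.zero_mem
  add_mem' := P.add_mem
  smul_mem' := fun c x hx => by
    rw [MulOpposite.smul_eq_mul_unop]
    exact P.mul_mem_right _ _ hx

/-- The central localization `Λ_p = Λ ⊗_R R_p` of an `R`-algebra `Λ` at a prime ideal `p` of
`R`. -/
noncomputable abbrev LocalizedAlg (R : Type u) [CommRing R] (Λ : Type u) [Ring Λ] [Algebra R Λ]
    (p : Ideal R) [p.IsPrime] : Type u :=
  Localization.AtPrime p ⊗[R] Λ

/-- The canonical ring homomorphism `φ : Λ → Λ_p`. -/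
noncomputable abbrev localizationRingHom (R : Type u) [CommRing R] (Λ : Type u) [Ring Λ]
    [Algebra R Λ] (p : Ideal R) [p.IsPrime] : Λ →+* LocalizedAlg R Λ p :=
  (Algebra.TensorProduct.includeRight (R := R) (A := Localization.AtPrime p) (B := Λ)).toRingHom


/-- The contraction `P ∩ R` of a two-sided ideal of `Λ` to the central subring `R`. -/
def TwoSidedIdeal.contract (R : Type u) [CommRing R] (Λ : Type u) [Ring Λ] [Algebra R Λ]
    (P : TwoSidedIdeal Λ) : Ideal R :=
  Ideal.comap (algebraMap R Λ) (TwoSidedIdeal.asIdeal (R := Λ) P)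

section Localization

variable {R : Type*} [CommRing R] {Λ : Type u} {Λ' : Type v} [Ring Λ] [Ring Λ'] [Algebra R Λ]
  [Algebra R Λ']

theorem TwoSidedIdeal.algebra_smul_mem (Q : TwoSidedIdeal Λ) (r : R) {a : Λ} (ha : a ∈ Q) :
    r • a ∈ Q := by
  rw [Algebra.smul_def]
  exact Q.mul_mem_left _ _ ha

theorem IsPrimeTwoSided.mem_of_smul_mem {Q : TwoSidedIdeal Λ} (hQ : IsPrimeTwoSided Q) {r : R}
    (hr : algebraMap R Λ r ∉ Q) {a : Λ} (ha : r • a ∈ Q) : a ∈ Q := by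
  refine (hQ.2 (algebraMap R Λ r) a fun x => ?_).resolve_left hr
  rw [Algebra.commutes r x, mul_assoc, ← Algebra.smul_def]
  exact Q.mul_mem_left _ _ ha

/-- Membership in a two-sided ideal of a localization may be tested after clearing denominators. -/
theorem TwoSidedIdeal.mem_of_smul_mem_of_isLocalizedModule (S : Submonoid R) (f : Λ →ₐ[R] Λ')
    [IsLocalizedModule S f.toLinearMap] (Q' : TwoSidedIdeal Λ') (s : S)
    {z : Λ'} (hz : s • z ∈ Q') : z ∈ Q' := by
  obtain ⟨y, hy⟩ := ((Module.End.isUnit_iff _).mp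
    (IsLocalizedModule.map_units f.toLinearMap s)).2 (1 : Λ')
  have hy : (s : R) • y = 1 := hy
  have : z = y * (s • z) := by
    rw [Submonoid.smul_def, mul_smul_comm, ← smul_mul_assoc, hy, one_mul]
  rw [this]
  exact Q'.mul_mem_left _ _ hz

theorem exists_smul_eq_of_isLocalizedModule (S : Submonoid R) (f : Λ →ₐ[R] Λ')
    [IsLocalizedModule S f.toLinearMap] (z : Λ') : ∃ (s : S) (a : Λ), s • z = f a := by
  obtain ⟨⟨a, s⟩, h⟩ := IsLocalizedModule.surj S f.toLinearMap z
  exact ⟨s, a, h⟩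

theorem TwoSidedIdeal.mem_span_image_iff (S : Submonoid R) (f : Λ →ₐ[R] Λ')
    [IsLocalizedModule S f.toLinearMap] (Q : TwoSidedIdeal Λ) (z : Λ') :
    z ∈ span (f '' Q) ↔ ∃ s : S, ∃ a ∈ Q, s • z = f a := by
  constructor
  · intro hz
    induction hz using span_induction with
    | mem x hx =>
      obtain ⟨a, ha, rfl⟩ := hx
      exact ⟨1, a, ha, one_smul _ _⟩
    | zero => exact ⟨1, 0, Q.zero_mem, by simp⟩
    | add x y _ _ hx hy =>
      obtain ⟨s, a, ha, hs⟩ := hx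
      obtain ⟨t, b, hb, ht⟩ := hy
      refine ⟨s * t, t • a + s • b,
        Q.add_mem (Q.algebra_smul_mem (t : R) ha) (Q.algebra_smul_mem (s : R) hb), ?_⟩
      rw [map_add, smul_add, mul_smul s t y, mul_comm s t, mul_smul, hs, ht]
      simp only [Submonoid.smul_def, map_smul]
    | neg x _ hx =>
      obtain ⟨s, a, ha, hs⟩ := hx
      exact ⟨s, -a, Q.neg_mem ha, by rw [smul_neg, hs, map_neg]⟩
    | left_absorb x y _ hy =>
      obtain ⟨s, a, ha, hs⟩ := hy
      obtain ⟨t, b, ht⟩ := exists_smul_eq_of_isLocalizedModule S f x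
      exact ⟨t * s, b * a, Q.mul_mem_left _ _ ha, by
        rw [map_mul, ← ht, ← hs]; exact (smul_mul_smul_comm (t : R) x (s : R) y).symm⟩
    | right_absorb y x _ hx =>
      obtain ⟨s, a, ha, hs⟩ := hx
      obtain ⟨t, b, ht⟩ := exists_smul_eq_of_isLocalizedModule S f y
      exact ⟨s * t, a * b, Q.mul_mem_right _ _ ha, by
        rw [map_mul, ← ht, ← hs]; exact (smul_mul_smul_comm (s : R) x (t : R) y).symm⟩
  · rintro ⟨s, a, ha, hs⟩
    refine mem_of_smul_mem_of_isLocalizedModule S f _ s ?_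
    rw [hs]
    exact subset_span ⟨a, ha, rfl⟩

theorem TwoSidedIdeal.comap_span_image (S : Submonoid R) (f : Λ →ₐ[R] Λ')
    [IsLocalizedModule S f.toLinearMap] {Q : TwoSidedIdeal Λ} (hQ : IsPrimeTwoSided Q)
    (hS : ∀ s : S, algebraMap R Λ s ∉ Q) : comap f (span (f '' Q)) = Q := by
  ext a
  rw [mem_comap]
  refine ⟨fun ha => ?_, fun ha => subset_span ⟨a, ha, rfl⟩⟩
  obtain ⟨s, b, hb, hs⟩ := (mem_span_image_iff S f Q _).mp ha
  have hab : f.toLinearMap (s • a) = f.toLinearMap b := (map_smul f (s : R) a).trans hs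
  obtain ⟨t, ht⟩ := IsLocalizedModule.exists_of_eq (S := S) hab
  refine hQ.mem_of_smul_mem (hS s) (hQ.mem_of_smul_mem (hS t) ?_)
  have : (t : R) • (s : R) • a = (t : R) • b := ht
  rw [this]
  exact Q.algebra_smul_mem _ hb

theorem TwoSidedIdeal.span_image_comap (S : Submonoid R) (f : Λ →ₐ[R] Λ')
    [IsLocalizedModule S f.toLinearMap] (Q' : TwoSidedIdeal Λ') :
    span (f '' (comap f Q' : TwoSidedIdeal Λ)) = Q' := by
  refine le_antisymm (span_le.mpr ?_) fun z hz => ?_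
  · rintro _ ⟨a, ha, rfl⟩
    exact (mem_comap f).mp ha
  · obtain ⟨s, a, hs⟩ := exists_smul_eq_of_isLocalizedModule S f z
    refine (mem_span_image_iff S f _ _).mpr ⟨s, a, (mem_comap f).mpr ?_, hs⟩
    rw [← hs]
    exact Q'.algebra_smul_mem (s : R) hz

theorem IsPrimeTwoSided.span_image (S : Submonoid R) (f : Λ →ₐ[R] Λ')
    [IsLocalizedModule S f.toLinearMap] {Q : TwoSidedIdeal Λ} (hQ : IsPrimeTwoSided Q)
    (hS : ∀ s : S, algebraMap R Λ s ∉ Q) : IsPrimeTwoSided (TwoSidedIdeal.span (f '' Q)) := by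
  have hcomap := TwoSidedIdeal.comap_span_image S f hQ hS
  refine ⟨fun h => hQ.1 ?_, fun z w hzw => ?_⟩
  · rw [← hcomap, h]
    ext a
    simp [TwoSidedIdeal.mem_comap, TwoSidedIdeal.mem_top]
  · obtain ⟨s, a, hs⟩ := exists_smul_eq_of_isLocalizedModule S f z
    obtain ⟨t, b, ht⟩ := exists_smul_eq_of_isLocalizedModule S f w
    refine (hQ.2 a b fun x => ?_).imp
      (fun ha => (TwoSidedIdeal.mem_span_image_iff S f Q z).mpr ⟨s, a, ha, hs⟩)
      (fun hb => (TwoSidedIdeal.mem_span_image_iff S f Q w).mpr ⟨t, b, hb, ht⟩)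
    rw [← hcomap, TwoSidedIdeal.mem_comap, map_mul, map_mul, ← hs, ← ht]
    simp only [Submonoid.smul_def, smul_mul_assoc, mul_smul_comm]
    exact TwoSidedIdeal.algebra_smul_mem _ _ (TwoSidedIdeal.algebra_smul_mem _ _ (hzw (f x)))

theorem IsPrimeTwoSided.comap (S : Submonoid R) (f : Λ →ₐ[R] Λ')
    [IsLocalizedModule S f.toLinearMap] {Q' : TwoSidedIdeal Λ'} (hQ' : IsPrimeTwoSided Q') :
    IsPrimeTwoSided (TwoSidedIdeal.comap f Q') := by
  refine ⟨fun h => hQ'.1 ?_, fun a b hab => ?_⟩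
  · rw [← TwoSidedIdeal.one_mem_iff, ← map_one f, ← TwoSidedIdeal.mem_comap, h]
    exact TwoSidedIdeal.mem_top _
  · simp only [TwoSidedIdeal.mem_comap] at hab ⊢
    refine hQ'.2 _ _ fun z => ?_
    obtain ⟨s, x, hs⟩ := exists_smul_eq_of_isLocalizedModule S f z
    refine TwoSidedIdeal.mem_of_smul_mem_of_isLocalizedModule S f Q' s ?_
    have := hab x
    rwa [map_mul, map_mul, ← hs, Submonoid.smul_def, mul_smul_comm, smul_mul_assoc] at this

theorem IsPrimeTwoSided.algebraMap_notMem_comap (S : Submonoid R) (f : Λ →ₐ[R] Λ')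
    [IsLocalizedModule S f.toLinearMap] {Q' : TwoSidedIdeal Λ'}
    (hQ' : IsPrimeTwoSided Q') (s : S) : algebraMap R Λ s ∉ TwoSidedIdeal.comap f Q' := by
  intro hs
  refine hQ'.1 ((TwoSidedIdeal.one_mem_iff _).mp
    (TwoSidedIdeal.mem_of_smul_mem_of_isLocalizedModule S f Q' s ?_))
  rwa [TwoSidedIdeal.mem_comap, AlgHom.commutes, Algebra.algebraMap_eq_smul_one] at hs

end Localization

/-- For a noetherian algebra `Λ` over a commutative noetherian ring `R` (contained in the
center of `Λ`) and a prime ideal `p` of `R`, the map `Q ↦ QΛ_p` is a bijection from the prime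
two-sided ideals `Q` of `Λ` with `Q ∩ R ⊆ p` onto the prime two-sided ideals of `Λ_p`, with
inverse `Q' ↦ φ⁻¹(Q')`. -/
theorem prime_twoSidedIdeals_of_localization
    (R : Type u) [CommRing R] [IsNoetherianRing R]
    (Λ : Type u) [Ring Λ] [Algebra R Λ]
    (hRcenter : Function.Injective (algebraMap R Λ)) [Module.Finite R Λ]
    (p : Ideal R) [p.IsPrime] :
    Set.BijOn
      (fun Q : TwoSidedIdeal Λ => TwoSidedIdeal.span (localizationRingHom R Λ p '' Q))
      {Q : TwoSidedIdeal Λ | IsPrimeTwoSided Q ∧ ∀ r : R, algebraMap R Λ r ∈ Q → r ∈ p}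
      {Q' : TwoSidedIdeal (LocalizedAlg R Λ p) | IsPrimeTwoSided Q'} ∧
    Set.InvOn
      (fun Q' : TwoSidedIdeal (LocalizedAlg R Λ p) =>
        TwoSidedIdeal.comap (localizationRingHom R Λ p) Q')
      (fun Q : TwoSidedIdeal Λ => TwoSidedIdeal.span (localizationRingHom R Λ p '' Q))
      {Q : TwoSidedIdeal Λ | IsPrimeTwoSided Q ∧ ∀ r : R, algebraMap R Λ r ∈ Q → r ∈ p}
      {Q' : TwoSidedIdeal (LocalizedAlg R Λ p) | IsPrimeTwoSided Q'} :=
  let φ : Λ →ₐ[R] LocalizedAlg R Λ p := Algebra.TensorProduct.includeRight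
  haveI : IsLocalizedModule p.primeCompl φ.toLinearMap :=
    (isLocalizedModule_iff_isBaseChange p.primeCompl (Localization.AtPrime p) _).mpr
      (TensorProduct.isBaseChange R Λ (Localization.AtPrime p))
  have hdisj : ∀ Q : TwoSidedIdeal Λ, (∀ r : R, algebraMap R Λ r ∈ Q → r ∈ p) ↔
      ∀ s : p.primeCompl, algebraMap R Λ s ∉ Q := fun Q =>
    ⟨fun h s hs => s.2 (h s hs), fun h r hr => by_contra fun hrp => h ⟨r, hrp⟩ hr⟩
  have hleft (Q : TwoSidedIdeal Λ)
      (hQ : IsPrimeTwoSided Q ∧ ∀ r : R, algebraMap R Λ r ∈ Q → r ∈ p) :=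
    TwoSidedIdeal.comap_span_image p.primeCompl φ hQ.1 ((hdisj Q).mp hQ.2)
  have hright (Q' : TwoSidedIdeal (LocalizedAlg R Λ p)) (_ : IsPrimeTwoSided Q') :=
    TwoSidedIdeal.span_image_comap p.primeCompl φ Q'
  ⟨Set.InvOn.bijOn ⟨hleft, hright⟩
    (fun _ hQ => hQ.1.span_image p.primeCompl φ ((hdisj _).mp hQ.2))
    (fun _ hQ' => ⟨IsPrimeTwoSided.comap p.primeCompl φ hQ',
      (hdisj _).mpr (IsPrimeTwoSided.algebraMap_notMem_comap p.primeCompl φ hQ')⟩),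
    hleft, hright⟩
end

section
/- Let R be a commutative noetherian ring and let Λ be a ring containing R as a subring of its center such that Λ is finitely generated as an R-module. For each prime two-sided ideal P of Λ, the ideal p = P ∩ R is a prime ideal of R, PΛ_p is a maximal two-sided ideal of Λ_p, and there is a unique isomorphism class S(P) of simple right Λ_p-modules whose annihilator is PΛ_p. The map P ↦ (P ∩ R, S(P)) is a bijection from the set of prime two-sided ideals of Λ onto the set of pairs (p, [S]) where p is a prime ideal of R and [S] is an isomorphism class of simple right Λ_p-modules. -/
universe u v

open scoped TensorProduct

section RightModules

variable {A : Type u} [Ring A]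

lemma mem_rightAnnihilator {S : Type v} [AddCommGroup S] [Module Aᵐᵒᵖ S] {a : A} :
    a ∈ rightAnnihilator A S ↔ ∀ x : S, MulOpposite.op a • x = 0 := by
  simp [rightAnnihilator, TwoSidedIdeal.mem_mk']

lemma TwoSidedIdeal.mem_toRightSubmodule {Q : TwoSidedIdeal A} {a : A} :
    a ∈ Q.toRightSubmodule ↔ a ∈ Q := Iff.rfl

lemma TwoSidedIdeal.ne_top_iff_one_notMem {Q : TwoSidedIdeal A} : Q ≠ ⊤ ↔ (1 : A) ∉ Q :=
  (TwoSidedIdeal.one_mem_iff Q).symm.not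

lemma LinearEquiv.rightAnnihilator_le {S S' : Type*} [AddCommGroup S] [Module Aᵐᵒᵖ S]
    [AddCommGroup S'] [Module Aᵐᵒᵖ S'] (e : S ≃ₗ[Aᵐᵒᵖ] S') :
    rightAnnihilator A S ≤ rightAnnihilator A S' := by
  intro a ha
  rw [mem_rightAnnihilator] at ha ⊢
  intro x
  rw [← e.apply_symm_apply x, ← map_smul, ha, map_zero]

lemma LinearEquiv.rightAnnihilator_eq {S S' : Type*} [AddCommGroup S] [Module Aᵐᵒᵖ S]
    [AddCommGroup S'] [Module Aᵐᵒᵖ S'] (e : S ≃ₗ[Aᵐᵒᵖ] S') :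
    rightAnnihilator A S = rightAnnihilator A S' :=
  le_antisymm e.rightAnnihilator_le e.symm.rightAnnihilator_le

lemma le_rightAnnihilator_quotient {Q : TwoSidedIdeal A} {M : Submodule Aᵐᵒᵖ A}
    (h : Q.toRightSubmodule ≤ M) : Q ≤ rightAnnihilator A (A ⧸ M) := by
  intro a ha
  rw [mem_rightAnnihilator]
  intro x
  obtain ⟨y, rfl⟩ := M.mkQ_surjective x
  rw [← map_smul, Submodule.mkQ_apply, Submodule.Quotient.mk_eq_zero]
  exact h (Q.mul_mem_left _ _ ha)

/-- The right annihilator of a simple right module is a prime ideal. -/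
lemma isPrimeTwoSided_rightAnnihilator (S : Type v) [AddCommGroup S] [Module Aᵐᵒᵖ S]
    [IsSimpleModule Aᵐᵒᵖ S] : IsPrimeTwoSided (rightAnnihilator A S) := by
  have := IsSimpleModule.nontrivial Aᵐᵒᵖ S
  refine ⟨?_, fun a b h => ?_⟩
  · rw [TwoSidedIdeal.ne_top_iff_one_notMem, mem_rightAnnihilator]
    intro h
    obtain ⟨x, hx⟩ := exists_ne (0 : S)
    exact hx (by simpa using h x)
  · by_contra! hab
    simp only [mem_rightAnnihilator, not_forall] at hab
    obtain ⟨⟨x, hx⟩, ⟨y, hy⟩⟩ := hab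
    obtain ⟨c, hc⟩ := IsSimpleModule.toSpanSingleton_surjective Aᵐᵒᵖ hx y
    apply hy
    have := mem_rightAnnihilator.1 (h c.unop) x
    rw [LinearMap.toSpanSingleton_apply] at hc
    rw [← hc]
    simpa [mul_smul] using this

/-- Every proper two-sided ideal annihilates some simple right module. -/
lemma exists_isSimpleModule_le_rightAnnihilator {Q : TwoSidedIdeal A} (hQ : Q ≠ ⊤) :
    ∃ M : Submodule Aᵐᵒᵖ A, IsSimpleModule Aᵐᵒᵖ (A ⧸ M) ∧ Q ≤ rightAnnihilator A (A ⧸ M) := by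
  have hfin : Module.Finite Aᵐᵒᵖ A :=
    ⟨⟨{1}, by
      rw [Finset.coe_singleton, eq_top_iff]
      exact fun a _ => Submodule.mem_span_singleton.2 ⟨MulOpposite.op a, by simp⟩⟩⟩
  have hne : Q.toRightSubmodule ≠ ⊤ := fun h =>
    TwoSidedIdeal.ne_top_iff_one_notMem.1 hQ (by
      rw [← TwoSidedIdeal.mem_toRightSubmodule, h]; trivial)
  obtain ⟨M, hM, hle⟩ := (eq_top_or_exists_le_coatom Q.toRightSubmodule).resolve_left hne
  exact ⟨M, isSimpleModule_iff_isCoatom.2 hM, le_rightAnnihilator_quotient hle⟩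

/-- A prime ideal with right artinian quotient is the annihilator of a simple right module. -/
lemma exists_isSimpleModule_rightAnnihilator_eq {Q : TwoSidedIdeal A} (hQ : IsPrimeTwoSided Q)
    [IsArtinian Aᵐᵒᵖ (A ⧸ Q.toRightSubmodule)] :
    ∃ S : Submodule Aᵐᵒᵖ (A ⧸ Q.toRightSubmodule), IsSimpleModule Aᵐᵒᵖ S ∧
      rightAnnihilator A S = Q := by
  have hnt : Nontrivial (A ⧸ Q.toRightSubmodule) := by
    refine Submodule.Quotient.nontrivial_iff.2 fun h => ?_
    refine TwoSidedIdeal.ne_top_iff_one_notMem.1 hQ.1 ?_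
    rw [← TwoSidedIdeal.mem_toRightSubmodule, h]; trivial
  obtain ⟨S, hS⟩ := IsAtomic.exists_atom (Submodule Aᵐᵒᵖ (A ⧸ Q.toRightSubmodule))
  refine ⟨S, isSimpleModule_iff_isAtom.2 hS, le_antisymm ?_ ?_⟩
  · intro a ha
    obtain ⟨x, hxS, hx⟩ := S.ne_bot_iff.1 hS.1
    obtain ⟨b, rfl⟩ := Q.toRightSubmodule.mkQ_surjective x
    refine (hQ.2 b a fun c => ?_).resolve_left fun hb =>
      hx ((Submodule.Quotient.mk_eq_zero _).2 hb)
    have := congrArg Subtype.val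
      (mem_rightAnnihilator.1 ha ⟨_, S.smul_mem (MulOpposite.op c) hxS⟩)
    exact (Submodule.Quotient.mk_eq_zero Q.toRightSubmodule (x := b * c * a)).1 this
  · intro a ha
    rw [mem_rightAnnihilator]
    intro x
    exact Subtype.ext (mem_rightAnnihilator.1 (le_rightAnnihilator_quotient le_rfl ha) x.1)

/-- The orbit map `a ↦ x a` of an element `x` of a right module annihilated by `Q`. -/
def rightOrbitMap {Q : TwoSidedIdeal A} {S : Type*} [AddCommGroup S] [Module Aᵐᵒᵖ S]
    (h : Q ≤ rightAnnihilator A S) (x : S) : (A ⧸ Q.toRightSubmodule) →ₗ[Aᵐᵒᵖ] S :=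
  Q.toRightSubmodule.liftQ
    { toFun := fun a => MulOpposite.op a • x
      map_add' := fun a b => by rw [MulOpposite.op_add, add_smul]
      map_smul' := fun c a => by
        rw [MulOpposite.smul_eq_mul_unop, MulOpposite.op_mul, mul_smul]; rfl }
    fun _ ha => mem_rightAnnihilator.1 (h ha) x

lemma rightOrbitMap_mk {Q : TwoSidedIdeal A} {S : Type*} [AddCommGroup S] [Module Aᵐᵒᵖ S]
    (h : Q ≤ rightAnnihilator A S) (x : S) (a : A) :
    rightOrbitMap h x (Q.toRightSubmodule.mkQ a) = MulOpposite.op a • x := rfl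

/-- A simple right module killed by the annihilator `Q` of a simple right module `S` is isomorphic
to `S`, provided that the quotient by `Q` is right artinian. -/
lemma nonempty_linearEquiv_of_le_rightAnnihilator {Q : TwoSidedIdeal A}
    [IsArtinian Aᵐᵒᵖ (A ⧸ Q.toRightSubmodule)] {S S' : Type*} [AddCommGroup S]
    [Module Aᵐᵒᵖ S] [AddCommGroup S'] [Module Aᵐᵒᵖ S'] [IsSimpleModule Aᵐᵒᵖ S]
    [IsSimpleModule Aᵐᵒᵖ S'] (hS : rightAnnihilator A S = Q) (hS' : Q ≤ rightAnnihilator A S') :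
    Nonempty (S ≃ₗ[Aᵐᵒᵖ] S') := by
  obtain ⟨s, hs⟩ := Finset.exists_inf_le fun x : S => LinearMap.ker (rightOrbitMap hS.ge x)
  let f : (A ⧸ Q.toRightSubmodule) →ₗ[Aᵐᵒᵖ] (s → S) :=
    LinearMap.pi fun x => rightOrbitMap hS.ge x.1
  have hf : Function.Injective f := by
    refine LinearMap.ker_eq_bot.1 (le_bot_iff.1 fun y hy => ?_)
    obtain ⟨a, rfl⟩ := Q.toRightSubmodule.mkQ_surjective y
    refine (Submodule.Quotient.mk_eq_zero _).2 ?_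
    rw [TwoSidedIdeal.mem_toRightSubmodule, ← hS, mem_rightAnnihilator]
    intro x
    have hmem : Q.toRightSubmodule.mkQ a ∈ LinearMap.ker (rightOrbitMap hS.ge x) :=
      hs x (Submodule.mem_finsetInf.2 fun i hi => congr_fun hy ⟨i, hi⟩)
    exact hmem
  have : IsSemisimpleModule Aᵐᵒᵖ (A ⧸ Q.toRightSubmodule) := .of_injective f hf
  have := IsSimpleModule.nontrivial Aᵐᵒᵖ S'
  obtain ⟨y, hy⟩ := exists_ne (0 : S')
  have hne : rightOrbitMap hS' y ≠ 0 := fun h => hy (by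
    rw [← one_smul Aᵐᵒᵖ y, ← MulOpposite.op_one, ← rightOrbitMap_mk hS', h, LinearMap.zero_apply])
  obtain ⟨N, ⟨e⟩⟩ := LinearMap.linearEquiv_of_ne_zero hne
  have hinj : Function.Injective fun z : S' => f (e z) :=
    hf.comp (Subtype.val_injective.comp e.injective)
  obtain ⟨i, hi⟩ : ∃ i, f (e y) i ≠ 0 := by
    by_contra! h
    exact hy (hinj ((funext h).trans (by simp; rfl)))
  let g : S' →ₗ[Aᵐᵒᵖ] S := LinearMap.proj i ∘ₗ f ∘ₗ N.subtype ∘ₗ e.toLinearMap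
  have hg : g ≠ 0 := fun h => hi (LinearMap.congr_fun h y)
  exact ⟨(LinearEquiv.ofBijective g (LinearMap.bijective_of_ne_zero hg)).symm⟩

/-- A prime ideal with right artinian quotient is maximal. -/
lemma IsPrimeTwoSided.isMaximalTwoSided {Q : TwoSidedIdeal A} (hQ : IsPrimeTwoSided Q)
    [IsArtinian Aᵐᵒᵖ (A ⧸ Q.toRightSubmodule)] : IsMaximalTwoSided Q := by
  refine ⟨hQ.1, fun Q' hlt => ?_⟩
  by_contra hne
  obtain ⟨S, _, hS⟩ := exists_isSimpleModule_rightAnnihilator_eq hQ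
  obtain ⟨M, _, hM⟩ := exists_isSimpleModule_le_rightAnnihilator hne
  obtain ⟨e⟩ := nonempty_linearEquiv_of_le_rightAnnihilator hS (hlt.le.trans hM)
  exact hlt.not_ge (hM.trans (e.rightAnnihilator_eq.symm.trans hS).le)

end RightModules

section FiniteOverLocalRing

variable {C : Type v} [CommRing C] [IsLocalRing C] {A : Type u} [Ring A] [Algebra C A]
  [Module.Finite C A]

/-- If a finite algebra over a local ring has a two-sided ideal `Q` containing the maximal ideal
of the base, then its quotient by `Q` is right artinian. -/
lemma isArtinian_quotient_of_maximalIdeal_le {Q : TwoSidedIdeal A}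
    (h : ∀ c ∈ IsLocalRing.maximalIdeal C, algebraMap C A c ∈ Q) :
    IsArtinian Aᵐᵒᵖ (A ⧸ Q.toRightSubmodule) := by
  have htor : Module.IsTorsionBySet C (A ⧸ Q.toRightSubmodule) (IsLocalRing.maximalIdeal C) := by
    intro x c
    obtain ⟨a, rfl⟩ := Q.toRightSubmodule.mkQ_surjective x
    refine (Submodule.Quotient.mk_eq_zero _).2 ?_
    change c.1 • a ∈ Q
    rw [Algebra.smul_def]
    exact Q.mul_mem_right _ _ (h _ c.2)
  have hfin : Module.Finite C (A ⧸ Q.toRightSubmodule) :=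
    Module.Finite.of_surjective (Q.toRightSubmodule.mkQ.restrictScalars C)
      Q.toRightSubmodule.mkQ_surjective
  let _ := htor.module
  have : IsScalarTower C (C ⧸ IsLocalRing.maximalIdeal C) (A ⧸ Q.toRightSubmodule) :=
    htor.isScalarTower
  let _ : Field (C ⧸ IsLocalRing.maximalIdeal C) := Ideal.Quotient.field _
  have : Module.Finite (C ⧸ IsLocalRing.maximalIdeal C) (A ⧸ Q.toRightSubmodule) :=
    Module.Finite.of_restrictScalars_finite C _ _
  have : IsArtinian C (A ⧸ Q.toRightSubmodule) :=
    isArtinian_of_surjective_algebraMap (R := C ⧸ IsLocalRing.maximalIdeal C)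
      Ideal.Quotient.mk_surjective
  exact isArtinian_of_tower C this

/-- The maximal ideal of the base annihilates every simple right module. -/
lemma algebraMap_mem_rightAnnihilator_of_mem_maximalIdeal (S : Type*) [AddCommGroup S]
    [Module Aᵐᵒᵖ S] [IsSimpleModule Aᵐᵒᵖ S] {c : C} (hc : c ∈ IsLocalRing.maximalIdeal C) :
    algebraMap C A c ∈ rightAnnihilator A S := by
  let _ : Module C S := Module.compHom S (algebraMap C Aᵐᵒᵖ)
  have hsmul (d : C) (x : S) : d • x = algebraMap C Aᵐᵒᵖ d • x := rfl
  have := IsSimpleModule.nontrivial Aᵐᵒᵖ S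
  obtain ⟨x, hx⟩ := exists_ne (0 : S)
  have : IsScalarTower C Aᵐᵒᵖ S := ⟨fun d a y => by rw [hsmul, Algebra.smul_def, mul_smul]⟩
  have : Module.Finite C Aᵐᵒᵖ := Module.Finite.equiv (MulOpposite.opLinearEquiv C)
  have : Module.Finite C S :=
    Module.Finite.of_surjective ((LinearMap.toSpanSingleton Aᵐᵒᵖ S x).restrictScalars C)
      (IsSimpleModule.toSpanSingleton_surjective Aᵐᵒᵖ hx)
  let f : S →ₗ[Aᵐᵒᵖ] S :=
    { toFun := fun y => algebraMap C Aᵐᵒᵖ c • y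
      map_add' := smul_add _
      map_smul' := fun a y => by
        rw [RingHom.id_apply, ← mul_smul, ← mul_smul, Algebra.commutes] }
  rcases f.bijective_or_eq_zero with hf | hf
  · exfalso
    refine top_ne_bot (α := Submodule C S)
      (Submodule.eq_bot_of_le_smul_of_le_jacobson_bot (IsLocalRing.maximalIdeal C) ⊤
        Module.Finite.fg_top (fun y _ => ?_) (IsLocalRing.maximalIdeal_le_jacobson _))
    obtain ⟨z, rfl⟩ := hf.2 y
    exact Submodule.smul_mem_smul (N := ⊤) (r := c) (n := z) hc trivial
  · rw [mem_rightAnnihilator]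
    exact fun y => LinearMap.congr_fun hf y

end FiniteOverLocalRing

section CentralLocalization

variable {R : Type u} [CommRing R] {Λ : Type u} [Ring Λ] [Algebra R Λ]

lemma TwoSidedIdeal.mem_contract {P : TwoSidedIdeal Λ} {r : R} :
    r ∈ P.contract R Λ ↔ algebraMap R Λ r ∈ P := Iff.rfl

lemma IsPrimeTwoSided.mem_or_mem_of_algebraMap_mul_mem {P : TwoSidedIdeal Λ}
    (hP : IsPrimeTwoSided P) {r : R} {a : Λ} (h : algebraMap R Λ r * a ∈ P) :
    r ∈ P.contract R Λ ∨ a ∈ P :=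
  hP.2 _ _ fun x => by
    rw [Algebra.commutes, mul_assoc]
    exact P.mul_mem_left _ _ h

lemma IsPrimeTwoSided.isPrime_contract {P : TwoSidedIdeal Λ} (hP : IsPrimeTwoSided P) :
    (P.contract R Λ).IsPrime := by
  refine ⟨fun h => ?_, fun {r s} hrs => ?_⟩
  · refine TwoSidedIdeal.ne_top_iff_one_notMem.1 hP.1 ?_
    rw [← map_one (algebraMap R Λ), ← TwoSidedIdeal.mem_contract, h]
    trivial
  · rw [TwoSidedIdeal.mem_contract, map_mul] at hrs
    exact hP.mem_or_mem_of_algebraMap_mul_mem hrs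

variable {p : Ideal R} [p.IsPrime]

lemma localizationRingHom_algebraMap (r : R) :
    localizationRingHom R Λ p (algebraMap R Λ r) = algebraMap R (LocalizedAlg R Λ p) r :=
  (Algebra.TensorProduct.includeRight (R := R) (A := Localization.AtPrime p) (B := Λ)).commutes r

lemma algebraMap_localizedAlg_mul (r : R) (a : LocalizedAlg R Λ p) :
    algebraMap R (LocalizedAlg R Λ p) r * a = r • a := (Algebra.smul_def r a).symm

lemma isUnit_algebraMap_localizedAlg {s : R} (hs : s ∉ p) :
    IsUnit (algebraMap R (LocalizedAlg R Λ p) s) := by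
  rw [IsScalarTower.algebraMap_apply R (Localization.AtPrime p)]
  exact (IsLocalization.map_units (Localization.AtPrime p)
    (⟨s, hs⟩ : p.primeCompl)).map (algebraMap (Localization.AtPrime p) (LocalizedAlg R Λ p))

lemma exists_smul_eq_localizationRingHom (a : LocalizedAlg R Λ p) :
    ∃ s ∉ p, ∃ x : Λ, algebraMap R (LocalizedAlg R Λ p) s * a = localizationRingHom R Λ p x := by
  obtain ⟨⟨x, s⟩, h⟩ := IsLocalizedModule.surj p.primeCompl
    (TensorProduct.mk R (Localization.AtPrime p) Λ 1) a
  exact ⟨s, s.2, x, (algebraMap_localizedAlg_mul _ _).trans h⟩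

lemma exists_algebraMap_mul_eq_of_localizationRingHom_eq {x y : Λ}
    (h : localizationRingHom R Λ p x = localizationRingHom R Λ p y) :
    ∃ s ∉ p, algebraMap R Λ s * x = algebraMap R Λ s * y := by
  obtain ⟨s, hs⟩ := (IsLocalizedModule.eq_iff_exists p.primeCompl
    (TensorProduct.mk R (Localization.AtPrime p) Λ 1)).1 h
  exact ⟨s, s.2, by simpa [Submonoid.smul_def, Algebra.smul_def] using hs⟩

lemma TwoSidedIdeal.mem_of_algebraMap_mul_mem (Q : TwoSidedIdeal (LocalizedAlg R Λ p)) {s : R}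
    (hs : s ∉ p) {a : LocalizedAlg R Λ p} (h : algebraMap R (LocalizedAlg R Λ p) s * a ∈ Q) :
    a ∈ Q := by
  obtain ⟨u, hu⟩ := isUnit_algebraMap_localizedAlg (Λ := Λ) hs
  rw [← hu] at h
  simpa using Q.mul_mem_left (↑u⁻¹) _ h

/-- Every two-sided ideal of the localization is extended from its contraction. -/
lemma TwoSidedIdeal.span_image_comap_s17 (Q : TwoSidedIdeal (LocalizedAlg R Λ p)) :
    TwoSidedIdeal.span (localizationRingHom R Λ p '' Q.comap (localizationRingHom R Λ p)) = Q := by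
  refine le_antisymm (TwoSidedIdeal.span_le.2 ?_) fun a ha => ?_
  · rintro _ ⟨x, hx, rfl⟩
    exact (TwoSidedIdeal.mem_comap _).1 hx
  · obtain ⟨s, hs, x, hx⟩ := exists_smul_eq_localizationRingHom a
    refine TwoSidedIdeal.mem_of_algebraMap_mul_mem _ hs ?_
    rw [hx]
    refine TwoSidedIdeal.subset_span ⟨x, (TwoSidedIdeal.mem_comap _).2 ?_, rfl⟩
    rw [← hx]
    exact Q.mul_mem_left _ _ ha

/-- Elements of `PΛ_p` are fractions with numerator in `P`. -/
lemma exists_of_mem_span_image {P : TwoSidedIdeal Λ} {a : LocalizedAlg R Λ p}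
    (ha : a ∈ TwoSidedIdeal.span (localizationRingHom R Λ p '' P)) :
    ∃ s ∉ p, ∃ x ∈ P, algebraMap R (LocalizedAlg R Λ p) s * a = localizationRingHom R Λ p x := by
  have hone : (1 : R) ∉ p := (Ideal.ne_top_iff_one p).1 ‹p.IsPrime›.ne_top
  have hmul {s t : R} (hs : s ∉ p) (ht : t ∉ p) : s * t ∉ p :=
    fun h => (‹p.IsPrime›.mem_or_mem h).elim hs ht
  let J : TwoSidedIdeal (LocalizedAlg R Λ p) := TwoSidedIdeal.mk'
    {a | ∃ s ∉ p, ∃ x ∈ P, algebraMap R (LocalizedAlg R Λ p) s * a = localizationRingHom R Λ p x}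
    ⟨1, hone, 0, P.zero_mem, by simp⟩
    (by
      rintro a b ⟨s, hs, x, hx, hax⟩ ⟨t, ht, y, hy, hby⟩
      refine ⟨s * t, hmul hs ht, algebraMap R Λ t * x + algebraMap R Λ s * y,
        P.add_mem (P.mul_mem_left _ _ hx) (P.mul_mem_left _ _ hy), ?_⟩
      rw [map_add, map_mul (localizationRingHom R Λ p), map_mul (localizationRingHom R Λ p), ← hax,
        ← hby, localizationRingHom_algebraMap,
        localizationRingHom_algebraMap]
      simp only [algebraMap_localizedAlg_mul, smul_smul, smul_add, mul_comm t s])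
    (by
      rintro a ⟨s, hs, x, hx, hax⟩
      refine ⟨s, hs, -x, P.neg_mem hx, ?_⟩
      rw [map_neg, ← hax]
      simp only [algebraMap_localizedAlg_mul, smul_neg])
    (by
      rintro a b ⟨t, ht, y, hy, hby⟩
      obtain ⟨s, hs, x, hax⟩ := exists_smul_eq_localizationRingHom a
      refine ⟨s * t, hmul hs ht, x * y, P.mul_mem_left _ _ hy, ?_⟩
      rw [map_mul (localizationRingHom R Λ p), ← hax, ← hby]
      simp only [algebraMap_localizedAlg_mul, smul_mul_smul_comm])
    (by
      rintro a b ⟨s, hs, x, hx, hax⟩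
      obtain ⟨t, ht, y, hby⟩ := exists_smul_eq_localizationRingHom b
      refine ⟨s * t, hmul hs ht, x * y, P.mul_mem_right _ _ hx, ?_⟩
      rw [map_mul (localizationRingHom R Λ p), ← hax, ← hby]
      simp only [algebraMap_localizedAlg_mul, smul_mul_smul_comm])
  have hJ : TwoSidedIdeal.span (localizationRingHom R Λ p '' P) ≤ J := by
    refine TwoSidedIdeal.span_le.2 ?_
    rintro _ ⟨x, hx, rfl⟩
    exact (TwoSidedIdeal.mem_mk' ..).2 ⟨1, hone, x, hx, by simp⟩
  simpa only [J, TwoSidedIdeal.mem_mk', Set.mem_ofPred_eq] using hJ ha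

/-- A prime ideal `P` over `p` is the contraction of its extension to `Λ_p`. -/
lemma IsPrimeTwoSided.localizationRingHom_mem_span_image_iff {P : TwoSidedIdeal Λ}
    (hP : IsPrimeTwoSided P) (hp : P.contract R Λ = p) {x : Λ} :
    localizationRingHom R Λ p x ∈ TwoSidedIdeal.span (localizationRingHom R Λ p '' P) ↔
      x ∈ P := by
  refine ⟨fun h => ?_, fun h => TwoSidedIdeal.subset_span ⟨x, h, rfl⟩⟩
  obtain ⟨s, hs, y, hy, hxy⟩ := exists_of_mem_span_image h
  rw [← localizationRingHom_algebraMap, ← map_mul] at hxy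
  obtain ⟨t, ht, hxy⟩ := exists_algebraMap_mul_eq_of_localizationRingHom_eq hxy
  have h1 : algebraMap R Λ t * (algebraMap R Λ s * x) ∈ P := hxy ▸ P.mul_mem_left _ _ hy
  subst hp
  exact (hP.mem_or_mem_of_algebraMap_mul_mem
    ((hP.mem_or_mem_of_algebraMap_mul_mem h1).resolve_left ht)).resolve_left hs

/-- The extension of a prime ideal over `p` to `Λ_p` is prime. -/
lemma IsPrimeTwoSided.span_image_s17 {P : TwoSidedIdeal Λ} (hP : IsPrimeTwoSided P)
    (hp : P.contract R Λ = p) :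
    IsPrimeTwoSided (TwoSidedIdeal.span (localizationRingHom R Λ p '' P)) := by
  refine ⟨?_, fun a b h => ?_⟩
  · rw [TwoSidedIdeal.ne_top_iff_one_notMem, ← map_one (localizationRingHom R Λ p),
      hP.localizationRingHom_mem_span_image_iff hp]
    exact TwoSidedIdeal.ne_top_iff_one_notMem.1 hP.1
  · obtain ⟨s, hs, x, hx⟩ := exists_smul_eq_localizationRingHom a
    obtain ⟨t, ht, y, hy⟩ := exists_smul_eq_localizationRingHom b
    refine (hP.2 x y fun z => ?_).imp (fun hxP => ?_) fun hyP => ?_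
    · rw [← hP.localizationRingHom_mem_span_image_iff hp, map_mul, map_mul, ← hx, ← hy]
      have : algebraMap R (LocalizedAlg R Λ p) s * a * localizationRingHom R Λ p z *
          (algebraMap R (LocalizedAlg R Λ p) t * b) =
          algebraMap R (LocalizedAlg R Λ p) (s * t) * (a * localizationRingHom R Λ p z * b) := by
        simp only [algebraMap_localizedAlg_mul, smul_mul_assoc, mul_smul_comm, smul_smul,
          mul_comm t s]
      rw [this]
      exact TwoSidedIdeal.mul_mem_left _ _ _ (h _)
    · refine TwoSidedIdeal.mem_of_algebraMap_mul_mem _ hs ?_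
      rw [hx]
      exact TwoSidedIdeal.subset_span ⟨x, hxP, rfl⟩
    · refine TwoSidedIdeal.mem_of_algebraMap_mul_mem _ ht ?_
      rw [hy]
      exact TwoSidedIdeal.subset_span ⟨y, hyP, rfl⟩

/-- The contraction of a prime ideal of `Λ_p` to `Λ` is prime. -/
lemma IsPrimeTwoSided.comap_localizationRingHom {Q : TwoSidedIdeal (LocalizedAlg R Λ p)}
    (hQ : IsPrimeTwoSided Q) : IsPrimeTwoSided (Q.comap (localizationRingHom R Λ p)) := by
  refine ⟨?_, fun x y h => ?_⟩
  · rw [TwoSidedIdeal.ne_top_iff_one_notMem, TwoSidedIdeal.mem_comap, map_one]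
    exact TwoSidedIdeal.ne_top_iff_one_notMem.1 hQ.1
  · simp only [TwoSidedIdeal.mem_comap] at h ⊢
    refine hQ.2 _ _ fun a => ?_
    obtain ⟨s, hs, z, hz⟩ := exists_smul_eq_localizationRingHom a
    refine TwoSidedIdeal.mem_of_algebraMap_mul_mem _ hs ?_
    have := h z
    rw [map_mul, map_mul, ← hz] at this
    simpa only [algebraMap_localizedAlg_mul, smul_mul_assoc, mul_smul_comm] using this

/-- If `P` lies over `p`, then `PΛ_p` contains the maximal ideal of `R_p`. -/
lemma algebraMap_mem_span_image_of_mem_maximalIdeal {P : TwoSidedIdeal Λ}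
    (hp : P.contract R Λ = p) {c : Localization.AtPrime p}
    (hc : c ∈ IsLocalRing.maximalIdeal (Localization.AtPrime p)) :
    algebraMap (Localization.AtPrime p) (LocalizedAlg R Λ p) c ∈
      TwoSidedIdeal.span (localizationRingHom R Λ p '' P) := by
  obtain ⟨⟨r, s⟩, hrs⟩ := IsLocalization.surj p.primeCompl c
  have hr : r ∈ p := by
    rw [← IsLocalization.AtPrime.to_map_mem_maximal_iff (Localization.AtPrime p) p, ← hrs]
    exact Ideal.mul_mem_right _ _ hc
  refine TwoSidedIdeal.mem_of_algebraMap_mul_mem _ s.2 ?_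
  rw [IsScalarTower.algebraMap_apply R (Localization.AtPrime p), ← map_mul, mul_comm, hrs,
    ← IsScalarTower.algebraMap_apply, ← localizationRingHom_algebraMap]
  exact TwoSidedIdeal.subset_span ⟨_, TwoSidedIdeal.mem_contract.1 (hp ▸ hr), rfl⟩

variable [Module.Finite R Λ]

lemma isArtinian_quotient_span_image {P : TwoSidedIdeal Λ} (hp : P.contract R Λ = p) :
    IsArtinian (LocalizedAlg R Λ p)ᵐᵒᵖ (LocalizedAlg R Λ p ⧸
      (TwoSidedIdeal.span (localizationRingHom R Λ p '' P)).toRightSubmodule) :=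
  isArtinian_quotient_of_maximalIdeal_le fun _ hc =>
    algebraMap_mem_span_image_of_mem_maximalIdeal hp hc

/-- The annihilator of a simple right `Λ_p`-module lies over `p`. -/
lemma contract_comap_rightAnnihilator (S : Type*) [AddCommGroup S]
    [Module (LocalizedAlg R Λ p)ᵐᵒᵖ S] [IsSimpleModule (LocalizedAlg R Λ p)ᵐᵒᵖ S] :
    ((rightAnnihilator (LocalizedAlg R Λ p) S).comap (localizationRingHom R Λ p)).contract R Λ =
      p := by
  ext r
  rw [TwoSidedIdeal.mem_contract, TwoSidedIdeal.mem_comap, localizationRingHom_algebraMap]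
  refine ⟨fun h => ?_, fun h => ?_⟩
  · by_contra hr
    refine TwoSidedIdeal.ne_top_iff_one_notMem.1
      (isPrimeTwoSided_rightAnnihilator (A := LocalizedAlg R Λ p) S).1
      (TwoSidedIdeal.mem_of_algebraMap_mul_mem _ hr ?_)
    rwa [mul_one]
  · rw [IsScalarTower.algebraMap_apply R (Localization.AtPrime p)]
    exact algebraMap_mem_rightAnnihilator_of_mem_maximalIdeal S
      ((IsLocalization.AtPrime.to_map_mem_maximal_iff (Localization.AtPrime p) p r).2 h)

end CentralLocalization

/-- For a noetherian algebra `Λ` over a commutative noetherian ring `R` (contained in the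
center of `Λ`): for every prime two-sided ideal `P` of `Λ`, the contraction `p = P ∩ R` is a
prime ideal of `R`, `PΛ_p` is a maximal two-sided ideal of `Λ_p`, and there is a unique
isomorphism class `S(P)` of simple right `Λ_p`-modules with annihilator `PΛ_p`; moreover the
assignment `P ↦ (P ∩ R, S(P))` is a bijection onto the pairs of a prime ideal `p` of `R`
together with an isomorphism class of simple right `Λ_p`-modules. -/
theorem primes_biject_with_pairs_of_prime_and_simple
    (R : Type u) [CommRing R] [IsNoetherianRing R]
    (Λ : Type u) [Ring Λ] [Algebra R Λ]
    (hRcenter : Function.Injective (algebraMap R Λ)) [Module.Finite R Λ] :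
    -- the contraction of a prime two-sided ideal is a prime ideal of `R`
    (∀ P : TwoSidedIdeal Λ, IsPrimeTwoSided P → (TwoSidedIdeal.contract R Λ P).IsPrime) ∧
    -- `PΛ_p` is a maximal two-sided ideal of `Λ_p`
    (∀ (P : TwoSidedIdeal Λ), IsPrimeTwoSided P →
      ∀ (p : Ideal R) (hp : p.IsPrime), TwoSidedIdeal.contract R Λ P = p →
        IsMaximalTwoSided (TwoSidedIdeal.span (localizationRingHom R Λ p '' P))) ∧
    -- existence and uniqueness of the simple right `Λ_p`-module `S(P)` with annihilator `PΛ_p`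
    (∀ (P : TwoSidedIdeal Λ), IsPrimeTwoSided P →
      ∀ (p : Ideal R) (hp : p.IsPrime), TwoSidedIdeal.contract R Λ P = p →
        (∃ (S : Type u) (_ : AddCommGroup S) (_ : Module (LocalizedAlg R Λ p)ᵐᵒᵖ S),
          IsSimpleModule (LocalizedAlg R Λ p)ᵐᵒᵖ S ∧
          rightAnnihilator (LocalizedAlg R Λ p) S =
            TwoSidedIdeal.span (localizationRingHom R Λ p '' P)) ∧
        (∀ (S S' : Type u) (_ : AddCommGroup S) (_ : Module (LocalizedAlg R Λ p)ᵐᵒᵖ S)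
            (_ : AddCommGroup S') (_ : Module (LocalizedAlg R Λ p)ᵐᵒᵖ S'),
          IsSimpleModule (LocalizedAlg R Λ p)ᵐᵒᵖ S →
          IsSimpleModule (LocalizedAlg R Λ p)ᵐᵒᵖ S' →
          rightAnnihilator (LocalizedAlg R Λ p) S =
            TwoSidedIdeal.span (localizationRingHom R Λ p '' P) →
          rightAnnihilator (LocalizedAlg R Λ p) S' =
            TwoSidedIdeal.span (localizationRingHom R Λ p '' P) →
          Nonempty (S ≃ₗ[(LocalizedAlg R Λ p)ᵐᵒᵖ] S'))) ∧
    -- injectivity of `P ↦ (P ∩ R, S(P))`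
    (∀ (P P' : TwoSidedIdeal Λ), IsPrimeTwoSided P → IsPrimeTwoSided P' →
      ∀ (p : Ideal R) (hp : p.IsPrime),
        TwoSidedIdeal.contract R Λ P = p → TwoSidedIdeal.contract R Λ P' = p →
        ∀ (S S' : Type u) (_ : AddCommGroup S) (_ : Module (LocalizedAlg R Λ p)ᵐᵒᵖ S)
          (_ : AddCommGroup S') (_ : Module (LocalizedAlg R Λ p)ᵐᵒᵖ S'),
          IsSimpleModule (LocalizedAlg R Λ p)ᵐᵒᵖ S →
          IsSimpleModule (LocalizedAlg R Λ p)ᵐᵒᵖ S' →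
          rightAnnihilator (LocalizedAlg R Λ p) S =
            TwoSidedIdeal.span (localizationRingHom R Λ p '' P) →
          rightAnnihilator (LocalizedAlg R Λ p) S' =
            TwoSidedIdeal.span (localizationRingHom R Λ p '' P') →
          Nonempty (S ≃ₗ[(LocalizedAlg R Λ p)ᵐᵒᵖ] S') → P = P') ∧
    -- surjectivity of `P ↦ (P ∩ R, S(P))`
    (∀ (p : Ideal R) (hp : p.IsPrime)
        (S : Type u) (_ : AddCommGroup S) (_ : Module (LocalizedAlg R Λ p)ᵐᵒᵖ S),
      IsSimpleModule (LocalizedAlg R Λ p)ᵐᵒᵖ S →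
        ∃ P : TwoSidedIdeal Λ, IsPrimeTwoSided P ∧ TwoSidedIdeal.contract R Λ P = p ∧
          rightAnnihilator (LocalizedAlg R Λ p) S =
            TwoSidedIdeal.span (localizationRingHom R Λ p '' P)) := by
  refine ⟨fun P hP => hP.isPrime_contract, fun P hP p hp hPp => ?_, fun P hP p hp hPp => ?_,
    fun P P' hP hP' p hp hPp hPp' S S' _ _ _ _ _ _ hS hS' ⟨e⟩ => ?_, fun p hp S _ _ _ => ?_⟩
  · have := isArtinian_quotient_span_image hPp
    exact (hP.span_image_s17 hPp).isMaximalTwoSided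
  · have := isArtinian_quotient_span_image hPp
    refine ⟨?_, fun S S' _ _ _ _ _ _ hS hS' =>
      nonempty_linearEquiv_of_le_rightAnnihilator hS hS'.ge⟩
    obtain ⟨S, hS, hann⟩ := exists_isSimpleModule_rightAnnihilator_eq (hP.span_image_s17 hPp)
    exact ⟨S, inferInstance, inferInstance, hS, hann⟩
  · have h := hS.symm.trans (e.rightAnnihilator_eq.trans hS')
    ext x
    rw [← hP.localizationRingHom_mem_span_image_iff hPp, h,
      hP'.localizationRingHom_mem_span_image_iff hPp']
  · exact ⟨_, (isPrimeTwoSided_rightAnnihilator S).comap_localizationRingHom,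
      contract_comap_rightAnnihilator S, (TwoSidedIdeal.span_image_comap_s17 _).symm⟩
end
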